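/- arXiv:2412.09061 — 5 statements merged into one kernel-verified Lean document; each statement's English description precedes it below -/
import Mathlib

section
/- Let n ≥ 1, Ψ : ℝⁿ → [0,∞), h ∈ ℝ, m ≠ 0, and let φ₀ : ℝ → ℝ be a smooth function with support contained in [1/4, 1]. Let Φ : ℝ × (ℝ∖{0}) × ℝⁿ → ℂ be smooth in its first variable and suppose there is C₁ > 0 such that |∂_s^k [Φ(2^N s, m, z)]| ≤ C₁ for k = 0, 1, for all (s, m, z) ∈ [1/4, 1] × (ℝ∖{0}) × ℝⁿ and all N ∈ ℤ. For t ≠ 0, z ∈ ℝⁿ and N ∈ ℤ define 𝒦_N^±(m,t,z) = ∫₀^∞ e^{−i t √(2^{4N} s⁴ + m²)} e^{± i 2^N s Ψ(z)} s^h φ₀(s) Φ(2^N s, m, z) ds, and when Ψ(z) > 0 set N₀ = ⌊log₂(Ψ(z)/|t|)⌋. Fix N″ ∈ ℤ and set C_m = 2 + (1/2) log₂(1 + 2^{−4(N″−2)} m²). Then there exists C > 0, depending only on C₁, φ₀, h and N″, such that for every N ≥ N″: |𝒦_N^±(m,t,z)| ≤ C ⟨m⟩^{1/2} (1 + |t|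 2^{2N})^{−1/2} whenever Ψ(z) > 0 and |N − N₀| ≤ C_m, and |𝒦_N^±(m,t,z)| ≤ C ⟨m⟩ (1 + |t| 2^{2N})^{−1} whenever Ψ(z) = 0 or |N − N₀| > C_m. -/
open MeasureTheory

theorem Continuous.eq_zero_of_forall_lt {f : ℝ → ℝ} {c : ℝ} (hf : Continuous f)
    (h : ∀ x < c, f x = 0) : f c = 0 := by
  have h1 : Set.EqOn f 0 (closure (Set.Iio c)) :=
    Set.EqOn.closure (fun x hx => h x hx) hf continuous_zero
  exact h1 (by simp)

theorem Continuous.eq_zero_of_forall_gt {f : ℝ → ℝ} {c : ℝ} (hf : Continuous f)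
    (h : ∀ x > c, f x = 0) : f c = 0 := by
  have h1 : Set.EqOn f 0 (closure (Set.Ioi c)) :=
    Set.EqOn.closure (fun x hx => h x hx) hf continuous_zero
  exact h1 (by simp)

/-- A smooth function supported in `[α, β]` vanishes to second order at `α`. -/
theorem exists_bound_of_support_subset_Icc {φ : ℝ → ℝ} {α β : ℝ} (hφ : ContDiff ℝ (⊤ : ℕ∞) φ)
    (hsupp : Function.support φ ⊆ Set.Icc α β) :
    ∃ M, 0 ≤ M ∧ ∀ s ∈ Set.Icc α β, |φ s| ≤ M * (s - α) ^ 2 ∧ |deriv φ s| ≤ M * (s - α) := by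
  have hz : ∀ x < α, φ x = 0 := fun x hx => by
    by_contra hne
    exact absurd (hsupp hne).1 (not_le.2 hx)
  have hφ2 : ContDiff ℝ 2 φ := contDiff_infty.1 hφ 2
  have hd : ContDiff ℝ 1 (deriv φ) := (contDiff_succ_iff_deriv (n := 1)).1 hφ2 |>.2.2
  have hdd : Continuous (deriv (deriv φ)) := hd.continuous_deriv le_rfl
  have h0 : φ α = 0 := hφ.continuous.eq_zero_of_forall_lt hz
  have h1 : deriv φ α = 0 := hd.continuous.eq_zero_of_forall_lt fun x hx => by
    have : φ =ᶠ[nhds x] fun _ => 0 := by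
      filter_upwards [Iio_mem_nhds hx] with y hy using hz y hy
    rw [this.deriv_eq, deriv_const]
  obtain ⟨M, hM⟩ := isCompact_Icc.exists_bound_of_continuousOn (s := Set.Icc α β) hdd.continuousOn
  have hM' : ∀ s ∈ Set.Icc α β, ‖deriv (deriv φ) s‖ ≤ max M 0 :=
    fun s hs => (hM s hs).trans (le_max_left _ _)
  have b1 : ∀ s ∈ Set.Icc α β, |deriv φ s| ≤ max M 0 * (s - α) := fun s hs => by
    have := (convex_Icc α β).norm_image_sub_le_of_norm_deriv_le
      (fun x _ => (hd.differentiable one_ne_zero).differentiableAt) hM'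
      ⟨le_rfl, hs.1.trans hs.2⟩ hs
    rwa [h1, sub_zero, Real.norm_eq_abs, Real.norm_eq_abs, abs_of_nonneg (sub_nonneg.2 hs.1)]
      at this
  refine ⟨max M 0, le_max_right _ _, fun s hs => ⟨?_, b1 s hs⟩⟩
  have := (convex_Icc α s).norm_image_sub_le_of_norm_deriv_le (f := φ) (C := max M 0 * (s - α))
    (fun x _ => (hφ2.differentiable two_ne_zero).differentiableAt)
    (fun x hx => (b1 x ⟨hx.1, hx.2.trans hs.2⟩).trans
      (mul_le_mul_of_nonneg_left (by linarith [hx.2]) (le_max_right _ _)))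
    ⟨le_rfl, hs.1⟩ ⟨hs.1, le_rfl⟩
  rw [h0, sub_zero, Real.norm_eq_abs, Real.norm_eq_abs, abs_of_nonneg (sub_nonneg.2 hs.1)] at this
  linarith [this]

/-- The amplitude `s ^ h * φ s * F s` vanishes to second order at the left end of the support
of `φ`, uniformly over all `F` bounded in `C¹`. -/
theorem exists_bound_rpow_mul_cutoff_mul {φ : ℝ → ℝ} {α β : ℝ} (hα : 0 < α)
    (hφ : ContDiff ℝ (⊤ : ℕ∞) φ) (hsupp : Function.support φ ⊆ Set.Icc α β) (h : ℝ) {C : ℝ}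
    (hC : 0 ≤ C) :
    ∃ B, 0 ≤ B ∧ ∀ F : ℝ → ℂ, ContDiff ℝ 1 F → (∀ s ∈ Set.Icc α β, ‖F s‖ ≤ C) →
      (∀ s ∈ Set.Icc α β, ‖deriv F s‖ ≤ C) →
      ∃ a' : ℝ → ℂ, ContinuousOn a' (Set.Icc α β) ∧ ∀ s ∈ Set.Icc α β,
        HasDerivAt (fun x => ((x ^ h : ℝ) : ℂ) * (φ x : ℂ) * F x) (a' s) s ∧
        ‖((s ^ h : ℝ) : ℂ) * (φ s : ℂ) * F s‖ ≤ B * (s - α) ^ 2 ∧ ‖a' s‖ ≤ B * (s - α) := by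
  obtain ⟨M, hM0, hM⟩ := exists_bound_of_support_subset_Icc hφ hsupp
  have hne : ∀ s ∈ Set.Icc α β, s ≠ 0 := fun s hs => (hα.trans_le hs.1).ne'
  have hpow : ∀ r : ℝ, ContinuousOn (fun s : ℝ => s ^ r) (Set.Icc α β) := fun r s hs =>
    (Real.continuousAt_rpow_const s r (Or.inl (hne s hs))).continuousWithinAt
  obtain ⟨P, hP⟩ := isCompact_Icc.exists_bound_of_continuousOn (hpow h)
  obtain ⟨Q, hQ⟩ := isCompact_Icc.exists_bound_of_continuousOn
    ((hpow (h - 1)).const_smul h)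
  set T := max (max P Q) 0 with hT
  have hT0 : 0 ≤ T := le_max_right _ _
  have hPT : ∀ s ∈ Set.Icc α β, |s ^ h| ≤ T := fun s hs =>
    (hP s hs).trans ((le_max_left P Q).trans (le_max_left _ _))
  have hQT : ∀ s ∈ Set.Icc α β, |h * s ^ (h - 1)| ≤ T := fun s hs =>
    (hQ s hs).trans ((le_max_right P Q).trans (le_max_left _ _))
  set E := max (β - α) 0 with hE
  have hE0 : 0 ≤ E := le_max_right _ _
  refine ⟨T * M * C * (2 * E + 1), by positivity, fun F hF hF0 hF1 => ?_⟩
  have hφ1 : ContDiff ℝ 1 φ := contDiff_infty.1 hφ 1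
  have c1 := hφ1.continuous_deriv le_rfl
  have c2 := hF.continuous_deriv le_rfl
  have c3 := hφ.continuous
  have c4 := hF.continuous
  have c5 := hpow h
  have c6 := hpow (h - 1)
  refine ⟨fun s => (((h * s ^ (h - 1) : ℝ) : ℂ) * (φ s : ℂ)
    + ((s ^ h : ℝ) : ℂ) * ((deriv φ s : ℝ) : ℂ)) * F s
    + ((s ^ h : ℝ) : ℂ) * (φ s : ℂ) * deriv F s, ?_, fun s hs => ⟨?_, ?_, ?_⟩⟩
  · have c7 : ContinuousOn (fun s : ℝ => h * s ^ (h - 1)) (Set.Icc α β) :=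
      continuousOn_const.mul c6
    fun_prop
  · exact (((Real.hasDerivAt_rpow_const (Or.inl (hne s hs))).ofReal_comp).mul
      ((hφ1.differentiable one_ne_zero s).hasDerivAt.ofReal_comp)).mul
      (hF.differentiable one_ne_zero s).hasDerivAt
  · simp only [norm_mul, Complex.norm_real, Real.norm_eq_abs]
    calc |s ^ h| * |φ s| * ‖F s‖ ≤ T * (M * (s - α) ^ 2) * C := by
          gcongr
          · exact hPT s hs
          · exact (hM s hs).1
          · exact hF0 s hs
      _ = T * M * C * 1 * (s - α) ^ 2 := by ring
      _ ≤ T * M * C * (2 * E + 1) * (s - α) ^ 2 := by gcongr; linarith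
  · have hd : 0 ≤ s - α := sub_nonneg.2 hs.1
    have hdE : s - α ≤ E := (sub_le_sub_right hs.2 α).trans (le_max_left _ _)
    have hφs : |φ s| ≤ M * (s - α) * E := by
      refine (hM s hs).1.trans ?_
      rw [pow_two, ← mul_assoc]
      gcongr
    refine (norm_add_le _ _).trans ?_
    rw [norm_mul]
    have hadd := fun u v w : ℂ => mul_le_mul_of_nonneg_right (norm_add_le u v) (norm_nonneg w)
    refine (add_le_add_left (hadd _ _ _) _).trans ?_
    simp only [norm_mul (_ : ℂ), Complex.norm_real, Real.norm_eq_abs]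
    calc (|h * s ^ (h - 1)| * |φ s| + |s ^ h| * |deriv φ s|) * ‖F s‖
          + |s ^ h| * |φ s| * ‖deriv F s‖
        ≤ (T * (M * (s - α) * E) + T * (M * (s - α))) * C + T * (M * (s - α) * E) * C := by
          gcongr
          · exact hQT s hs
          · exact hPT s hs
          · exact (hM s hs).2
          · exact hF0 s hs
          · exact hPT s hs
          · exact hF1 s hs
      _ = T * M * C * (2 * E + 1) * (s - α) := by ring

section KleinGordonPhase

variable {A m s : ℝ}

theorem hasDerivAt_sqrt_quartic (hA : 0 < A) (hs : 0 < s) :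
    HasDerivAt (fun x => √(A * x ^ 4 + m ^ 2)) (2 * A * s ^ 3 / √(A * s ^ 4 + m ^ 2)) s := by
  have hr : 0 < A * s ^ 4 + m ^ 2 := by positivity
  have h1 := (((hasDerivAt_pow 4 s).const_mul A).add_const (m ^ 2)).sqrt hr.ne'
  refine h1.congr_deriv ?_
  have := (Real.sqrt_pos.2 hr).ne'
  field_simp
  norm_num

theorem hasDerivAt_deriv_sqrt_quartic (hA : 0 < A) (hs : 0 < s) :
    HasDerivAt (fun x => 2 * A * x ^ 3 / √(A * x ^ 4 + m ^ 2))
      (6 * A * s ^ 2 / √(A * s ^ 4 + m ^ 2) - 4 * A ^ 2 * s ^ 6 / √(A * s ^ 4 + m ^ 2) ^ 3) s := by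
  have hr : 0 < A * s ^ 4 + m ^ 2 := by positivity
  have hr' := (Real.sqrt_pos.2 hr).ne'
  have h1 := ((hasDerivAt_pow 3 s).const_mul (2 * A)).div
    (hasDerivAt_sqrt_quartic (m := m) hA hs) hr'
  refine h1.congr_deriv ?_
  field_simp
  norm_num
  ring

theorem deriv2_sqrt_quartic_bounds (hA : 0 < A) (hs : s ∈ Set.Icc (1 / 4 : ℝ) 1) :
    A / √(A + m ^ 2) / 8 ≤
        6 * A * s ^ 2 / √(A * s ^ 4 + m ^ 2) - 4 * A ^ 2 * s ^ 6 / √(A * s ^ 4 + m ^ 2) ^ 3 ∧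
      6 * A * s ^ 2 / √(A * s ^ 4 + m ^ 2) - 4 * A ^ 2 * s ^ 6 / √(A * s ^ 4 + m ^ 2) ^ 3
        ≤ 6 * (A / √(A + m ^ 2)) := by
  have hs0 : 0 < s := by linarith [hs.1]
  have hr : 0 < A * s ^ 4 + m ^ 2 := by positivity
  have hr' := Real.sqrt_pos.2 hr
  have hq : 0 < √(A + m ^ 2) := Real.sqrt_pos.2 (by positivity)
  have hr2 : √(A * s ^ 4 + m ^ 2) ^ 2 = A * s ^ 4 + m ^ 2 := Real.sq_sqrt hr.le
  have hs4 : s ^ 4 ≤ 1 := pow_le_one₀ hs0.le hs.2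
  have hrq : √(A * s ^ 4 + m ^ 2) ≤ √(A + m ^ 2) := Real.sqrt_le_sqrt (by nlinarith)
  have hqr : s ^ 2 * √(A + m ^ 2) ≤ √(A * s ^ 4 + m ^ 2) := by
    refine Real.le_sqrt_of_sq_le ?_
    rw [mul_pow, Real.sq_sqrt (by positivity)]
    nlinarith [mul_nonneg (sub_nonneg.2 hs4) (sq_nonneg m)]
  set r := √(A * s ^ 4 + m ^ 2)
  set q := √(A + m ^ 2)
  constructor
  · have h1 : 4 * A ^ 2 * s ^ 6 / r ^ 3 ≤ 4 * A * s ^ 2 / r := by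
      rw [div_le_div_iff₀ (by positivity) hr']
      calc 4 * A ^ 2 * s ^ 6 * r = 4 * A * s ^ 2 * r * (A * s ^ 4) := by ring
        _ ≤ 4 * A * s ^ 2 * r * r ^ 2 := by
            gcongr; rw [hr2]; nlinarith [sq_nonneg m]
        _ = _ := by ring
    have h2 : A / q / 8 ≤ 2 * A * s ^ 2 / r := by
      rw [div_div, div_le_div_iff₀ (by positivity) hr']
      have hs2 : 1 / 16 ≤ s ^ 2 := by nlinarith [hs.1]
      calc A * r ≤ A * q := by gcongr
        _ = 2 * A * (1 / 16) * (q * 8) := by ring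
        _ ≤ 2 * A * s ^ 2 * (q * 8) := by gcongr
    have h3 : 6 * A * s ^ 2 / r = 2 * A * s ^ 2 / r + 4 * A * s ^ 2 / r := by ring
    linarith
  · have h1 : 0 ≤ 4 * A ^ 2 * s ^ 6 / r ^ 3 := by positivity
    have h2 : 6 * A * s ^ 2 / r ≤ 6 * (A / q) := by
      rw [← mul_div_assoc, div_le_div_iff₀ hr' hq]
      nlinarith [mul_le_mul_of_nonneg_left hqr hA.le]
    linarith

theorem deriv_sqrt_quartic_sub_ge (hA : 0 < A) (hs : s ∈ Set.Icc (1 / 4 : ℝ) 1) :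
    A / √(A + m ^ 2) / 8 * (s - 1 / 4) ≤ 2 * A * s ^ 3 / √(A * s ^ 4 + m ^ 2)
      - 2 * A * (1 / 4) ^ 3 / √(A * (1 / 4) ^ 4 + m ^ 2) := by
  have hd : ∀ x ∈ Set.Icc (1 / 4 : ℝ) 1, HasDerivAt (fun x => 2 * A * x ^ 3 / √(A * x ^ 4 + m ^ 2))
      _ x := fun x hx => hasDerivAt_deriv_sqrt_quartic hA (by linarith [hx.1])
  refine (convex_Icc (1 / 4 : ℝ) 1).mul_sub_le_image_sub_of_le_deriv
    (f := fun x => 2 * A * x ^ 3 / √(A * x ^ 4 + m ^ 2))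
    (fun x hx => (hd x hx).continuousAt.continuousWithinAt)
    (fun x hx => (hd x (interior_subset hx)).differentiableAt.differentiableWithinAt)
    (fun x hx => ?_) _ (by norm_num) _ hs hs.1
  rw [(hd x (interior_subset hx)).deriv]
  exact (deriv2_sqrt_quartic_bounds hA (interior_subset hx)).1

theorem deriv_sqrt_quartic_le (hA : 0 < A) (hs : s ∈ Set.Icc (1 / 4 : ℝ) 1) :
    2 * A * s ^ 3 / √(A * s ^ 4 + m ^ 2) ≤ 2 * √A := by
  have hs0 : 0 < s := by linarith [hs.1]
  have hr' : 0 < √(A * s ^ 4 + m ^ 2) := Real.sqrt_pos.2 (by positivity)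
  have h1 : √A * s ^ 2 ≤ √(A * s ^ 4 + m ^ 2) := by
    refine Real.le_sqrt_of_sq_le ?_
    rw [mul_pow, Real.sq_sqrt hA.le]
    nlinarith [sq_nonneg m]
  rw [div_le_iff₀ hr']
  have hA2 : √A ^ 2 = A := Real.sq_sqrt hA.le
  have hA0 := Real.sqrt_nonneg A
  calc 2 * A * s ^ 3 = 2 * √A * (√A * s ^ 2) * s := by rw [← hA2]; simp; ring
    _ ≤ 2 * √A * √(A * s ^ 4 + m ^ 2) * 1 := by gcongr; exact hs.2
    _ = _ := by ring

end KleinGordonPhase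

theorem hasDerivAt_exp_I_mul_ofReal {p : ℝ → ℝ} {p' s : ℝ} (hp : HasDerivAt p p' s) :
    HasDerivAt (fun x => Complex.exp (Complex.I * (p x : ℂ)))
      (Complex.exp (Complex.I * (p s : ℂ)) * (Complex.I * (p' : ℂ))) s :=
  (hp.ofReal_comp.const_mul Complex.I).cexp

/-- Nonstationary phase with one integration by parts: the phase derivative may degenerate linearly
at the left endpoint, where the amplitude vanishes to second order. -/
theorem norm_integral_mul_exp_le_of_le_abs_deriv {α β B K μ : ℝ} (hαβ : α ≤ β) (hB : 0 ≤ B)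
    (hμ : 0 < μ) {a a' : ℝ → ℂ} {p p' p'' : ℝ → ℝ}
    (ha : ∀ s ∈ Set.Icc α β, HasDerivAt a (a' s) s) (ha' : ContinuousOn a' (Set.Icc α β))
    (hp : ∀ s ∈ Set.Icc α β, HasDerivAt p (p' s) s)
    (hp' : ∀ s ∈ Set.Icc α β, HasDerivAt p' (p'' s) s) (hp'' : ContinuousOn p'' (Set.Icc α β))
    (haB : ∀ s ∈ Set.Icc α β, ‖a s‖ ≤ B * (s - α) ^ 2)
    (haB' : ∀ s ∈ Set.Icc α β, ‖a' s‖ ≤ B * (s - α)) (haβ : a β = 0)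
    (hlow : ∀ s ∈ Set.Icc α β, μ * (s - α) ≤ |p' s|)
    (hup : ∀ s ∈ Set.Icc α β, |p'' s| ≤ K * μ) :
    ‖∫ s in α..β, a s * Complex.exp (Complex.I * (p s : ℂ))‖ ≤ (B * (1 + K) / μ) * (β - α) := by
  have hαm : α ∈ Set.Icc α β := ⟨le_rfl, hαβ⟩
  have haα : a α = 0 := by simpa using haB α hαm
  have hac : ContinuousOn a (Set.Icc α β) := fun s hs => (ha s hs).continuousAt.continuousWithinAt
  have hpc : ContinuousOn p (Set.Icc α β) := fun s hs => (hp s hs).continuousAt.continuousWithinAt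
  have hpc' : ContinuousOn p' (Set.Icc α β) :=
    fun s hs => (hp' s hs).continuousAt.continuousWithinAt
  have hec : ContinuousOn (fun s => Complex.exp (Complex.I * (p s : ℂ))) (Set.Icc α β) := by
    fun_prop
  have hne : ∀ s ∈ Set.Ioc α β, p' s ≠ 0 := fun s hs h0 => by
    have := hlow s ⟨hs.1.le, hs.2⟩
    rw [h0, abs_zero] at this
    nlinarith [mul_pos hμ (sub_pos.2 hs.1)]
  have hneC : ∀ s ∈ Set.Ioc α β, Complex.I * (p' s : ℂ) ≠ 0 := fun s hs =>
    mul_ne_zero Complex.I_ne_zero (by exact_mod_cast hne s hs)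
  set G : ℝ → ℂ := fun s =>
    a s * Complex.exp (Complex.I * (p s : ℂ)) * (Complex.I * (p' s : ℂ))⁻¹ with hG
  set R : ℝ → ℂ := fun s => a' s * Complex.exp (Complex.I * (p s : ℂ)) * (Complex.I * (p' s : ℂ))⁻¹
    + a s * Complex.exp (Complex.I * (p s : ℂ))
      * (-(Complex.I * (p'' s : ℂ)) / (Complex.I * (p' s : ℂ)) ^ 2) with hR
  have hGd : ∀ s ∈ Set.Ioo α β,
      HasDerivAt G (a s * Complex.exp (Complex.I * (p s : ℂ)) + R s) s := fun s hs => by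
    have hs' := Set.Ioo_subset_Icc_self hs
    have hn := hneC s ⟨hs.1, hs.2.le⟩
    have h1 := ((ha s hs').mul (hasDerivAt_exp_I_mul_ofReal (hp s hs'))).mul
      (((hp' s hs').ofReal_comp.const_mul Complex.I).fun_inv hn)
    refine h1.congr_deriv ?_
    have hn2 : (p' s : ℂ) ≠ 0 := by exact_mod_cast hne s ⟨hs.1, hs.2.le⟩
    simp only [hR, Pi.mul_apply]
    field_simp
    ring
  have hRb : ∀ s ∈ Set.Ioo α β, ‖R s‖ ≤ B * (1 + K) / μ := fun s hs => by
    have hs' := Set.Ioo_subset_Icc_self hs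
    have hd : 0 < s - α := sub_pos.2 hs.1
    have hpos : 0 < |p' s| := abs_pos.2 (hne s ⟨hs.1, hs.2.le⟩)
    have hl := hlow s hs'
    have h1 : ‖a' s‖ / |p' s| ≤ B / μ := by
      rw [div_le_div_iff₀ hpos hμ]
      calc ‖a' s‖ * μ ≤ B * (s - α) * μ := by gcongr; exact haB' s hs'
        _ = B * (μ * (s - α)) := by ring
        _ ≤ B * |p' s| := by gcongr
    have h2 : ‖a s‖ * (|p'' s| / |p' s| ^ 2) ≤ B * K / μ := by
      rw [← mul_div_assoc, div_le_div_iff₀ (by positivity) hμ]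
      have hK : 0 ≤ K * μ := (abs_nonneg _).trans (hup s hs')
      have hK' : 0 ≤ K := nonneg_of_mul_nonneg_left hK hμ
      calc ‖a s‖ * |p'' s| * μ ≤ (B * (s - α) ^ 2) * (K * μ) * μ := by
            gcongr
            · exact haB s hs'
            · exact hup s hs'
        _ = B * K * (μ * (s - α)) ^ 2 := by ring
        _ ≤ B * K * |p' s| ^ 2 := by gcongr
    calc ‖R s‖ ≤ ‖a' s‖ / |p' s| + ‖a s‖ * (|p'' s| / |p' s| ^ 2) := by
          refine (norm_add_le _ _).trans (le_of_eq ?_)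
          simp [Complex.norm_exp_I_mul_ofReal, div_eq_mul_inv]
      _ ≤ B / μ + B * K / μ := add_le_add h1 h2
      _ = B * (1 + K) / μ := by ring
  have hRc : ContinuousOn R (Set.Ioo α β) := by
    have hsub := Set.Ioo_subset_Icc_self (a := α) (b := β)
    have e := hec.mono hsub
    have c1 := ha'.mono hsub
    have c2 := hac.mono hsub
    have c3 := hpc'.mono hsub
    have c4 := hp''.mono hsub
    have c3' : ContinuousOn (fun s => Complex.I * (p' s : ℂ)) (Set.Ioo α β) := by fun_prop
    have c4' : ContinuousOn (fun s => -(Complex.I * (p'' s : ℂ))) (Set.Ioo α β) := by fun_prop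
    exact ((c1.mul e).mul (c3'.inv₀ fun s hs => hneC s ⟨hs.1, hs.2.le⟩)).add
      ((c2.mul e).mul (c4'.div (c3'.pow 2) fun s hs => pow_ne_zero _ (hneC s ⟨hs.1, hs.2.le⟩)))
  have hRi : IntervalIntegrable R volume α β := by
    rw [intervalIntegrable_iff_integrableOn_Ioo_of_le hαβ]
    exact ⟨hRc.aestronglyMeasurable measurableSet_Ioo,
      HasFiniteIntegral.restrict_of_bounded (B * (1 + K) / μ) (by simp)
        ((ae_restrict_mem measurableSet_Ioo).mono hRb)⟩
  have hFi : IntervalIntegrable (fun s => a s * Complex.exp (Complex.I * (p s : ℂ))) volume α β :=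
    (hac.mul hec).intervalIntegrable_of_Icc hαβ
  have hGc : ContinuousOn G (Set.Icc α β) := fun s hs => by
    rcases hs.1.eq_or_lt with rfl | hlt
    · have hbd : ∀ x ∈ Set.Icc α β, ‖G x‖ ≤ B / μ * (x - α) := fun x hx => by
        rcases hx.1.eq_or_lt with rfl | hx1
        · simp [hG, haα]
        · have hd : 0 < x - α := sub_pos.2 hx1
          have hpos : 0 < |p' x| := abs_pos.2 (hne x ⟨hx1, hx.2⟩)
          have : ‖G x‖ = ‖a x‖ / |p' x| := by
            simp [hG, Complex.norm_exp_I_mul_ofReal, div_eq_mul_inv]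
          rw [this, div_mul_eq_mul_div, div_le_div_iff₀ hpos hμ]
          calc ‖a x‖ * μ ≤ B * (x - α) ^ 2 * μ := by gcongr; exact haB x hx
            _ = B * (x - α) * (μ * (x - α)) := by ring
            _ ≤ B * (x - α) * |p' x| := by gcongr; exact hlow x hx
      have hz : G α = 0 := by simp [hG, haα]
      rw [ContinuousWithinAt, hz]
      refine squeeze_zero_norm' (a := fun x => B / μ * (x - α))
        (eventually_mem_nhdsWithin.mono hbd) ?_
      have : ContinuousAt (fun x : ℝ => B / μ * (x - α)) α := by fun_prop
      simpa [ContinuousAt] using this.tendsto.mono_left (nhdsWithin_le_nhds (s := Set.Icc α β))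
    · exact ((hac s hs).mul (hec s hs)).mul
        (((continuous_const.continuousWithinAt).mul
          (Complex.continuous_ofReal.continuousAt.comp_continuousWithinAt (hpc' s hs))).inv₀
          (hneC s ⟨hlt, hs.2⟩))
  have key := intervalIntegral.integral_eq_sub_of_hasDerivAt_of_le hαβ hGc hGd (hFi.add hRi)
  have hGβ : G β = 0 := by simp [hG, haβ]
  have hGα : G α = 0 := by simp [hG, haα]
  rw [intervalIntegral.integral_add hFi hRi, hGβ, hGα, sub_zero, add_eq_zero_iff_eq_neg] at key
  rw [key, norm_neg, ← abs_of_nonneg (sub_nonneg.2 hαβ)]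
  refine intervalIntegral.norm_integral_le_of_norm_le_const_ae ?_
  rw [Set.uIoc_of_le hαβ]
  filter_upwards [compl_mem_ae_iff.2 (measure_singleton β)] with s hs hs'
  exact hRb s ⟨hs'.1, lt_of_le_of_ne hs'.2 hs⟩

/-- Second-derivative van der Corput estimate for an amplitude vanishing at both endpoints. -/
theorem norm_integral_mul_exp_le_of_le_deriv2 {α β B μ σ : ℝ} (hαβ : α ≤ β) (hB : 0 ≤ B)
    (hμ : 0 < μ) (hσ : |σ| = 1) {a a' : ℝ → ℂ} {p p' p'' : ℝ → ℝ}
    (ha : ∀ s ∈ Set.Icc α β, HasDerivAt a (a' s) s) (ha' : ContinuousOn a' (Set.Icc α β))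
    (hp : ∀ s ∈ Set.Icc α β, HasDerivAt p (p' s) s)
    (hp' : ∀ s ∈ Set.Icc α β, HasDerivAt p' (p'' s) s) (hp'' : ContinuousOn p'' (Set.Icc α β))
    (haB : ∀ s ∈ Set.Icc α β, ‖a s‖ ≤ B) (haB' : ∀ s ∈ Set.Icc α β, ‖a' s‖ ≤ B)
    (haα : a α = 0) (haβ : a β = 0)
    (hlow : ∀ s ∈ Set.Icc α β, μ ≤ σ * p'' s) :
    ‖∫ s in α..β, a s * Complex.exp (Complex.I * (p s : ℂ))‖
      ≤ B * (β - α + 2 * Real.pi) / √μ := by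
  have hac : ContinuousOn a (Set.Icc α β) := fun s hs => (ha s hs).continuousAt.continuousWithinAt
  have hpc : ContinuousOn p (Set.Icc α β) := fun s hs => (hp s hs).continuousAt.continuousWithinAt
  have hpc' : ContinuousOn p' (Set.Icc α β) :=
    fun s hs => (hp' s hs).continuousAt.continuousWithinAt
  have hec : ContinuousOn (fun s => Complex.exp (Complex.I * (p s : ℂ))) (Set.Icc α β) := by
    fun_prop
  have hq : ∀ s, 0 < p' s ^ 2 + μ := fun s => by positivity
  have hsq : 0 < √μ := Real.sqrt_pos.2 hμ
  have hsq2 : √μ ^ 2 = μ := Real.sq_sqrt hμ.le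
  set w : ℝ → ℝ := fun s => p' s / (p' s ^ 2 + μ) with hw
  set w' : ℝ → ℝ := fun s => p'' s * (μ - p' s ^ 2) / (p' s ^ 2 + μ) ^ 2 with hw'
  have hwd : ∀ s ∈ Set.Icc α β, HasDerivAt w (w' s) s := fun s hs => by
    refine ((hp' s hs).div (((hp' s hs).pow 2).add_const μ) (hq s).ne').congr_deriv ?_
    simp only [hw', Pi.pow_apply]
    ring_nf
  have hwc : ContinuousOn w (Set.Icc α β) := fun s hs => (hwd s hs).continuousAt.continuousWithinAt
  have hqc : ContinuousOn (fun s => p' s ^ 2 + μ) (Set.Icc α β) := by fun_prop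
  have hwc' : ContinuousOn w' (Set.Icc α β) :=
    (hp''.mul (continuousOn_const.sub (hpc'.pow 2))).div (hqc.pow 2)
      fun s _ => pow_ne_zero _ (hq s).ne'
  set G : ℝ → ℂ := fun s => -Complex.I * (a s * Complex.exp (Complex.I * (p s : ℂ)) * (w s : ℂ))
    with hG
  set R : ℝ → ℂ := fun s => Complex.I * (a' s * Complex.exp (Complex.I * (p s : ℂ)) * (w s : ℂ))
    + Complex.I * (a s * Complex.exp (Complex.I * (p s : ℂ)) * (w' s : ℂ))
    + a s * Complex.exp (Complex.I * (p s : ℂ)) * ((μ / (p' s ^ 2 + μ) : ℝ) : ℂ) with hR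
  have hGd : ∀ s ∈ Set.Icc α β,
      HasDerivAt G (a s * Complex.exp (Complex.I * (p s : ℂ)) - R s) s := fun s hs => by
    have h1 := (((ha s hs).mul (hasDerivAt_exp_I_mul_ofReal (hp s hs))).mul
      (hwd s hs).ofReal_comp).const_mul (-Complex.I)
    refine h1.congr_deriv ?_
    have e1 : (1 : ℂ) = (p' s : ℂ) * (w s : ℂ) + ((μ / (p' s ^ 2 + μ) : ℝ) : ℂ) := by
      rw [← Complex.ofReal_mul, ← Complex.ofReal_add, ← Complex.ofReal_one]
      congr 1
      have := (hq s).ne'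
      simp only [hw]
      field_simp
    simp only [hR, Pi.mul_apply]
    linear_combination (-(a s) * Complex.exp (Complex.I * (p s : ℂ))) * e1
      - a s * Complex.exp (Complex.I * (p s : ℂ)) * p' s * w s * Complex.I_mul_I
  have hRb : ∀ s ∈ Set.Icc α β,
      ‖R s‖ ≤ B / √μ + 2 * B * (σ * p'' s / (p' s ^ 2 + μ)) := fun s hs => by
    have habs : |p'' s| = σ * p'' s := by
      rw [← one_mul |p'' s|, ← hσ, ← abs_mul, abs_of_nonneg (hμ.le.trans (hlow s hs))]
    have h1 : |w s| ≤ 1 / √μ := by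
      rw [hw, abs_div, abs_of_pos (hq s), div_le_div_iff₀ (hq s) hsq, ← sq_abs (p' s)]
      nlinarith [sq_nonneg (|p' s| - √μ), abs_nonneg (p' s), mul_nonneg (abs_nonneg (p' s)) hsq.le]
    have h2 : |w' s| ≤ σ * p'' s / (p' s ^ 2 + μ) := by
      rw [hw', abs_div, abs_mul, habs, abs_of_pos (pow_pos (hq s) 2),
        div_le_div_iff₀ (pow_pos (hq s) 2) (hq s)]
      have h3 : |μ - p' s ^ 2| ≤ p' s ^ 2 + μ := by
        rw [abs_le]; constructor <;> nlinarith [sq_nonneg (p' s)]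
      have h4 : 0 ≤ σ * p'' s := hμ.le.trans (hlow s hs)
      calc σ * p'' s * |μ - p' s ^ 2| * (p' s ^ 2 + μ)
          ≤ σ * p'' s * (p' s ^ 2 + μ) * (p' s ^ 2 + μ) := by
            have := (hq s).le
            gcongr
        _ = _ := by ring
    have h3 : μ / (p' s ^ 2 + μ) ≤ σ * p'' s / (p' s ^ 2 + μ) := by
      have := (hq s).le
      gcongr
      exact hlow s hs
    have h4 : ‖((μ / (p' s ^ 2 + μ) : ℝ) : ℂ)‖ = μ / (p' s ^ 2 + μ) := by
      rw [Complex.norm_real, Real.norm_of_nonneg (div_nonneg hμ.le (hq s).le)]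
    calc ‖R s‖ ≤ ‖a' s‖ * |w s| + ‖a s‖ * |w' s| + ‖a s‖ * (μ / (p' s ^ 2 + μ)) := by
          refine (norm_add₃_le).trans (le_of_eq ?_)
          simp only [norm_mul, Complex.norm_exp_I_mul_ofReal, h4, Complex.norm_I, Complex.norm_real,
            Real.norm_eq_abs, one_mul, mul_one]
      _ ≤ B * (1 / √μ) + B * (σ * p'' s / (p' s ^ 2 + μ)) + B * (σ * p'' s / (p' s ^ 2 + μ)) := by
          have := div_nonneg hμ.le (hq s).le
          gcongr
          · exact haB' s hs
          · exact haB s hs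
          · exact haB s hs
      _ = _ := by ring
  have hRc : ContinuousOn R (Set.Icc α β) := by
    have h5 : ContinuousOn (fun s => μ / (p' s ^ 2 + μ)) (Set.Icc α β) :=
      continuousOn_const.div hqc fun s _ => (hq s).ne'
    fun_prop
  have hFi : IntervalIntegrable (fun s => a s * Complex.exp (Complex.I * (p s : ℂ))) volume α β :=
    (hac.mul hec).intervalIntegrable_of_Icc hαβ
  have hRi := hRc.intervalIntegrable_of_Icc (μ := volume) hαβ
  have key := intervalIntegral.integral_eq_sub_of_hasDerivAt
    (fun s hs => hGd s (by rwa [Set.uIcc_of_le hαβ] at hs)) (hFi.sub hRi)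
  have hGβ : G β = 0 := by simp [hG, haβ]
  have hGα : G α = 0 := by simp [hG, haα]
  rw [intervalIntegral.integral_sub hFi hRi, hGβ, hGα, sub_zero, sub_eq_zero] at key
  rw [key]
  set H : ℝ → ℝ := fun s => B / √μ * s + 2 * B * σ / √μ * Real.arctan (p' s / √μ) with hH
  have hHd : ∀ s ∈ Set.uIcc α β,
      HasDerivAt H (B / √μ + 2 * B * (σ * p'' s / (p' s ^ 2 + μ))) s := fun s hs => by
    rw [Set.uIcc_of_le hαβ] at hs
    have h1 := ((hasDerivAt_id s).const_mul (B / √μ)).add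
      ((((hp' s hs).div_const (√μ)).arctan).const_mul (2 * B * σ / √μ))
    refine h1.congr_deriv ?_
    have := (hq s).ne'
    have e : 1 + (p' s / √μ) ^ 2 = (p' s ^ 2 + μ) / μ := by
      rw [div_pow, hsq2]; field_simp; ring
    rw [e, mul_one]
    congr 1
    have e2 : 2 * B * σ / √μ * (1 / ((p' s ^ 2 + μ) / μ) * (p'' s / √μ))
      = 2 * B * σ * p'' s * μ / ((p' s ^ 2 + μ) * √μ ^ 2) := by field_simp
    rw [e2, hsq2]
    field_simp
  have hHc : ContinuousOn (fun s => B / √μ + 2 * B * (σ * p'' s / (p' s ^ 2 + μ)))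
      (Set.Icc α β) :=
    continuousOn_const.add (continuousOn_const.mul
      ((continuousOn_const.mul hp'').div hqc fun s _ => (hq s).ne'))
  have hHi := hHc.intervalIntegrable_of_Icc (μ := volume) hαβ
  have hbound := intervalIntegral.norm_integral_le_of_norm_le hαβ
    (Filter.Eventually.of_forall fun s hs => hRb s (Set.Ioc_subset_Icc_self hs)) hHi
  rw [intervalIntegral.integral_eq_sub_of_hasDerivAt hHd hHi] at hbound
  refine hbound.trans ?_
  have hat : σ * (Real.arctan (p' β / √μ) - Real.arctan (p' α / √μ)) ≤ Real.pi := by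
    refine (le_abs_self _).trans ?_
    rw [abs_mul, hσ, one_mul, abs_le]
    have := Real.arctan_lt_pi_div_two (p' β / √μ)
    have := Real.arctan_lt_pi_div_two (p' α / √μ)
    have := Real.neg_pi_div_two_lt_arctan (p' β / √μ)
    have := Real.neg_pi_div_two_lt_arctan (p' α / √μ)
    constructor <;> linarith
  calc H β - H α = B / √μ * (β - α) + 2 * (B / √μ) *
        (σ * (Real.arctan (p' β / √μ) - Real.arctan (p' α / √μ))) := by simp only [hH]; ring
    _ ≤ B / √μ * (β - α) + 2 * (B / √μ) * Real.pi := by gcongr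
    _ = _ := by ring

section Estimates

variable {a a' : ℝ → ℂ} {A m t v B : ℝ}

/-- Uniform decay from the nondegenerate second derivative of the phase. -/
theorem norm_integral_quartic_phase_le_sqrt (hA : 0 < A) (ht : t ≠ 0) (hB : 0 ≤ B)
    (ha : ∀ s ∈ Set.Icc (1 / 4 : ℝ) 1, HasDerivAt a (a' s) s)
    (ha' : ContinuousOn a' (Set.Icc (1 / 4) 1))
    (haB : ∀ s ∈ Set.Icc (1 / 4 : ℝ) 1, ‖a s‖ ≤ B * (s - 1 / 4) ^ 2)
    (haB' : ∀ s ∈ Set.Icc (1 / 4 : ℝ) 1, ‖a' s‖ ≤ B * (s - 1 / 4)) (ha1 : a 1 = 0) :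
    ‖∫ s in (1 / 4 : ℝ)..1,
        a s * Complex.exp (Complex.I * ((-(t * √(A * s ^ 4 + m ^ 2)) + v * s : ℝ) : ℂ))‖
      ≤ B * (1 - 1 / 4 + 2 * Real.pi) / √(|t| * (A / √(A + m ^ 2) / 8)) := by
  have hD : 0 < A / √(A + m ^ 2) := div_pos hA (Real.sqrt_pos.2 (by positivity))
  have hpos : ∀ s ∈ Set.Icc (1 / 4 : ℝ) 1, 0 < s := fun s hs => by linarith [hs.1]
  refine norm_integral_mul_exp_le_of_le_deriv2 (σ := -(SignType.sign t : ℝ)) (by norm_num) hB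
    (mul_pos (abs_pos.2 ht) (by positivity)) ?_ ha ha'
    (fun s hs => (((hasDerivAt_sqrt_quartic hA (hpos s hs)).const_mul t).neg).add
      ((hasDerivAt_id s).const_mul v))
    (fun s hs => (((hasDerivAt_deriv_sqrt_quartic hA (hpos s hs)).const_mul t).neg).add_const _)
    ?_ (fun s hs => (haB s hs).trans ?_) (fun s hs => (haB' s hs).trans ?_) ?_ ha1 ?_
  · rcases ht.lt_or_gt with h | h <;> simp [h]
  · have hr : ∀ s ∈ Set.Icc (1 / 4 : ℝ) 1, √(A * s ^ 4 + m ^ 2) ≠ 0 := fun s hs =>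
      (Real.sqrt_pos.2 (by have := hpos s hs; positivity)).ne'
    have hr3 : ∀ s ∈ Set.Icc (1 / 4 : ℝ) 1, √(A * s ^ 4 + m ^ 2) ^ 3 ≠ 0 := fun s hs =>
      pow_ne_zero _ (hr s hs)
    fun_prop (disch := assumption)
  · exact mul_le_of_le_one_right hB (by nlinarith [hs.1, hs.2])
  · exact mul_le_of_le_one_right hB (by linarith [hs.2])
  · simpa using haB (1 / 4) (by norm_num)
  · intro s hs
    have h1 := (deriv2_sqrt_quartic_bounds (m := m) hA hs).1
    rw [neg_mul_neg, ← mul_assoc, sign_mul_self]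
    exact mul_le_mul_of_nonneg_left h1 (abs_nonneg t)

/-- Stronger decay when the derivative of the phase does not vanish inside the support. -/
theorem norm_integral_quartic_phase_le (hA : 0 < A) (ht : t ≠ 0) (hB : 0 ≤ B)
    (ha : ∀ s ∈ Set.Icc (1 / 4 : ℝ) 1, HasDerivAt a (a' s) s)
    (ha' : ContinuousOn a' (Set.Icc (1 / 4) 1))
    (haB : ∀ s ∈ Set.Icc (1 / 4 : ℝ) 1, ‖a s‖ ≤ B * (s - 1 / 4) ^ 2)
    (haB' : ∀ s ∈ Set.Icc (1 / 4 : ℝ) 1, ‖a' s‖ ≤ B * (s - 1 / 4)) (ha1 : a 1 = 0)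
    (hv : |v| ≤ |t| * (2 * A * (1 / 4) ^ 3 / √(A * (1 / 4) ^ 4 + m ^ 2)) ∨
      8 * √A * |t| ≤ |v|) :
    ‖∫ s in (1 / 4 : ℝ)..1,
        a s * Complex.exp (Complex.I * ((-(t * √(A * s ^ 4 + m ^ 2)) + v * s : ℝ) : ℂ))‖
      ≤ B * (1 + 48) / (|t| * (A / √(A + m ^ 2) / 8)) * (1 - 1 / 4) := by
  have hD : 0 < A / √(A + m ^ 2) := div_pos hA (Real.sqrt_pos.2 (by positivity))
  have hpos : ∀ s ∈ Set.Icc (1 / 4 : ℝ) 1, 0 < s := fun s hs => by linarith [hs.1]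
  have ht0 := abs_pos.2 ht
  refine norm_integral_mul_exp_le_of_le_abs_deriv (by norm_num) hB
    (mul_pos ht0 (by positivity)) ha ha'
    (fun s hs => (((hasDerivAt_sqrt_quartic hA (hpos s hs)).const_mul t).neg).add
      ((hasDerivAt_id s).const_mul v))
    (fun s hs => (((hasDerivAt_deriv_sqrt_quartic hA (hpos s hs)).const_mul t).neg).add_const _)
    ?_ haB haB' ha1 ?_ ?_
  · have hr : ∀ s ∈ Set.Icc (1 / 4 : ℝ) 1, √(A * s ^ 4 + m ^ 2) ≠ 0 := fun s hs =>
      (Real.sqrt_pos.2 (by have := hpos s hs; positivity)).ne'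
    have hr3 : ∀ s ∈ Set.Icc (1 / 4 : ℝ) 1, √(A * s ^ 4 + m ^ 2) ^ 3 ≠ 0 := fun s hs =>
      pow_ne_zero _ (hr s hs)
    fun_prop (disch := assumption)
  · intro s hs
    have hf : 0 ≤ 2 * A * s ^ 3 / √(A * s ^ 4 + m ^ 2) := by have := hpos s hs; positivity
    have habs : |-(t * (2 * A * s ^ 3 / √(A * s ^ 4 + m ^ 2)))|
        = |t| * (2 * A * s ^ 3 / √(A * s ^ 4 + m ^ 2)) := by
      rw [abs_neg, abs_mul, abs_of_nonneg hf]
    rw [mul_one]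
    rcases hv with hv | hv
    · have h1 := mul_le_mul_of_nonneg_left (deriv_sqrt_quartic_sub_ge (m := m) hA hs) ht0.le
      have h2 := abs_sub_abs_le_abs_add (-(t * (2 * A * s ^ 3 / √(A * s ^ 4 + m ^ 2)))) v
      rw [habs] at h2
      linarith
    · have h1 := mul_le_mul_of_nonneg_left (deriv_sqrt_quartic_le (m := m) hA hs) ht0.le
      have h2 := abs_sub_abs_le_abs_add v (-(t * (2 * A * s ^ 3 / √(A * s ^ 4 + m ^ 2))))
      rw [habs, add_comm v] at h2
      have h3 : A / √(A + m ^ 2) ≤ √A := by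
        rw [div_le_iff₀ (Real.sqrt_pos.2 (by positivity))]
        calc A = √A * √A := (Real.mul_self_sqrt hA.le).symm
          _ ≤ _ := by gcongr; nlinarith [sq_nonneg m]
      have h4 : |t| * (A / √(A + m ^ 2) / 8) * (s - 1 / 4) ≤ |t| * √A := by
        rw [mul_assoc]
        gcongr
        nlinarith [hs.1, hs.2]
      have := mul_nonneg ht0.le (Real.sqrt_nonneg A)
      linarith
  · intro s hs
    have h1 := deriv2_sqrt_quartic_bounds (m := m) hA hs
    rw [abs_neg, abs_mul, abs_of_nonneg (le_trans (by positivity) h1.1)]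
    have := mul_le_mul_of_nonneg_left h1.2 ht0.le
    linarith

theorem sq_div_le_div_sqrt {ℓ κ : ℝ} (hℓ : 0 < ℓ) (hκ : 1 ≤ κ * ℓ ^ 2) (hκ1 : 1 ≤ κ) :
    ℓ ^ 2 / (κ * (1 + |m|)) ≤ ℓ ^ 4 / √(ℓ ^ 4 + m ^ 2) := by
  have hm := abs_nonneg m
  have hκ0 : 0 < κ := by linarith
  rw [div_le_div_iff₀ (by positivity) (Real.sqrt_pos.2 (by positivity))]
  have h1 : √(ℓ ^ 4 + m ^ 2) ≤ ℓ ^ 2 + |m| := by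
    refine Real.sqrt_le_iff.2 ⟨by positivity, ?_⟩
    nlinarith [sq_abs m, mul_nonneg (sq_nonneg ℓ) hm]
  have h2 : ℓ ^ 2 + |m| ≤ ℓ ^ 2 * (κ * (1 + |m|)) := by
    nlinarith [mul_le_mul_of_nonneg_right hκ hm, mul_le_mul_of_nonneg_left hκ1 (sq_nonneg ℓ)]
  calc ℓ ^ 2 * √(ℓ ^ 4 + m ^ 2) ≤ ℓ ^ 2 * (ℓ ^ 2 * (κ * (1 + |m|))) := by
        gcongr; exact h1.trans h2
    _ = _ := by ring

end Estimates

/-- If the dyadic scale `N` is far from `⌊log₂ (ψ / |t|)⌋`, then `2 ^ N * ψ` stays outside the range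
of `|t|` times the derivative of `√(2 ^ (4 N) s ^ 4 + m ^ 2)` over `[1/4, 1]`. -/
theorem frequency_separation {ψ t m : ℝ} (hψ : 0 < ψ) (ht : t ≠ 0) {N N₁ : ℤ} (hN : N₁ ≤ N)
    (hsep : 2 + (1/2) * Real.logb 2 (1 + (2:ℝ)^(-(4*(N₁-2))) * m^2)
      < ((|N - ⌊Real.logb 2 (ψ / |t|)⌋| : ℤ) : ℝ)) :
    (2:ℝ) ^ N * ψ ≤ |t| * (2 * ((2:ℝ) ^ N) ^ 4 * (1 / 4) ^ 3 /
        √(((2:ℝ) ^ N) ^ 4 * (1 / 4) ^ 4 + m ^ 2)) ∨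
      8 * ((2:ℝ) ^ N) ^ 2 * |t| ≤ (2:ℝ) ^ N * ψ := by
  have ht0 := abs_pos.2 ht
  have hx : 0 < ψ / |t| := div_pos hψ ht0
  set Q : ℝ := 1 + (2:ℝ)^(-(4*(N₁-2))) * m^2 with hQ
  have hQ1 : 1 ≤ Q := by
    have : 0 ≤ (2:ℝ)^(-(4*(N₁-2))) * m^2 := by positivity
    linarith
  have hlogQ : 0 ≤ Real.logb 2 Q := Real.logb_nonneg one_lt_two hQ1
  set N₀ := ⌊Real.logb 2 (ψ / |t|)⌋ with hN₀
  set ℓ : ℝ := (2:ℝ) ^ N with hℓ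
  have hℓ0 : 0 < ℓ := by positivity
  set k : ℝ := (2:ℝ) ^ N₀ with hk
  have hk0 : 0 < k := by positivity
  have hk1 : k * |t| ≤ ψ := by
    rw [← le_div_iff₀ ht0, hk, ← Real.rpow_intCast, ← Real.le_logb_iff_rpow_le one_lt_two hx]
    exact Int.floor_le _
  have hk2 : ψ < 2 * k * |t| := by
    have : (2:ℝ) * k = (2:ℝ) ^ (N₀ + 1) := by rw [zpow_add_one₀ two_ne_zero, mul_comm]
    rw [← div_lt_iff₀ ht0, this, ← Real.rpow_intCast,
      ← Real.logb_lt_iff_lt_rpow one_lt_two hx]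
    push_cast
    exact Int.lt_floor_add_one _
  rcases le_total N N₀ with hle | hle
  · right
    have h3 : (2:ℝ) < ((N₀ - N : ℤ) : ℝ) := by
      rw [abs_of_nonpos (sub_nonpos.2 hle), neg_sub] at hsep
      linarith
    have h4 : 3 + N ≤ N₀ := by
      have : (2 : ℤ) < N₀ - N := by exact_mod_cast h3
      omega
    have h5 : 8 * ℓ ≤ k := by
      have := zpow_le_zpow_right₀ (one_le_two (α := ℝ)) h4
      rw [zpow_add₀ two_ne_zero] at this
      norm_num at this
      exact this
    calc 8 * ℓ ^ 2 * |t| = ℓ * (8 * ℓ * |t|) := by ring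
      _ ≤ ℓ * (k * |t|) := by gcongr
      _ ≤ ℓ * ψ := by gcongr
  · left
    rw [abs_of_nonneg (sub_nonneg.2 hle)] at hsep
    have h1 : Q < (2:ℝ) ^ (2 * (N - N₀) - 4) := by
      rw [← Real.rpow_intCast, ← Real.logb_lt_iff_lt_rpow one_lt_two (by linarith)]
      push_cast at hsep ⊢
      linarith
    have h2 : (2:ℝ) ^ (2 * (N - N₀) - 4) = ℓ ^ 2 / (16 * k ^ 2) := by
      rw [zpow_sub₀ two_ne_zero, mul_comm, zpow_mul, zpow_sub₀ two_ne_zero]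
      norm_num [div_pow]
      rw [← hℓ, ← hk]
      field_simp
    rw [h2, lt_div_iff₀ (by positivity)] at h1
    have h3 : 256 * m ^ 2 / ℓ ^ 4 ≤ (2:ℝ)^(-(4*(N₁-2))) * m^2 := by
      have e : (2:ℝ)^(-(4*(N₁-2))) = 256 * (2:ℝ) ^ (-(4 * N₁)) := by
        rw [show -(4*(N₁-2)) = 8 + -(4 * N₁) by ring, zpow_add₀ two_ne_zero]
        norm_num
      have e2 : (1:ℝ) / ℓ ^ 4 = (2:ℝ) ^ (-(4 * N)) := by
        rw [hℓ, zpow_neg, mul_comm 4 N, zpow_mul, one_div]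
        norm_cast
      have e3 : (2:ℝ) ^ (-(4 * N)) ≤ (2:ℝ) ^ (-(4 * N₁)) :=
        zpow_le_zpow_right₀ one_le_two (by omega)
      rw [e, div_eq_mul_one_div, e2]
      nlinarith [mul_le_mul_of_nonneg_right e3 (sq_nonneg m)]
    have h4 : 16 * k ^ 2 * (ℓ ^ 4 + 256 * m ^ 2) ≤ ℓ ^ 6 := by
      have e : ℓ ^ 4 + 256 * m ^ 2 = ℓ ^ 4 * (1 + 256 * m ^ 2 / ℓ ^ 4) := by field_simp
      rw [e]
      calc 16 * k ^ 2 * (ℓ ^ 4 * (1 + 256 * m ^ 2 / ℓ ^ 4))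
          ≤ 16 * k ^ 2 * (ℓ ^ 4 * Q) := by gcongr; linarith
        _ = ℓ ^ 4 * (Q * (16 * k ^ 2)) := by ring
        _ ≤ ℓ ^ 4 * ℓ ^ 2 := by gcongr
        _ = _ := by ring
    have hr : 0 < ℓ ^ 4 * (1 / 4) ^ 4 + m ^ 2 := by positivity
    have h5 : 64 * k * √(ℓ ^ 4 * (1 / 4) ^ 4 + m ^ 2) ≤ ℓ ^ 3 := by
      refine (sq_le_sq₀ (by positivity) (by positivity)).1 ?_
      rw [mul_pow, Real.sq_sqrt hr.le]
      linarith
    rw [← mul_div_assoc, le_div_iff₀ (Real.sqrt_pos.2 hr)]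
    calc ℓ * ψ * √(ℓ ^ 4 * (1 / 4) ^ 4 + m ^ 2)
        ≤ ℓ * (2 * k * |t|) * √(ℓ ^ 4 * (1 / 4) ^ 4 + m ^ 2) := by gcongr
      _ = ℓ * |t| / 32 * (64 * k * √(ℓ ^ 4 * (1 / 4) ^ 4 + m ^ 2)) := by ring
      _ ≤ ℓ * |t| / 32 * ℓ ^ 3 := by gcongr
      _ = _ := by ring

theorem le_mul_one_add_inv {J B c g X : ℝ} (hX : 0 < X) (hB : 0 ≤ B) (hg : 1 ≤ g) (h1 : J ≤ B)
    (h2 : J ≤ c * g / X) : J ≤ (B + c) * g * (1 + X)⁻¹ := by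
  rw [← div_eq_mul_inv, le_div_iff₀ (by positivity)]
  rw [le_div_iff₀ hX] at h2
  nlinarith [mul_le_mul_of_nonneg_left hg hB]

theorem le_mul_rpow_one_add {J B c g X : ℝ} (hX : 0 < X) (hJ : 0 ≤ J) (hB : 0 ≤ B) (hc : 0 ≤ c)
    (hg : 1 ≤ g) (h1 : J ≤ B) (h2 : J ≤ c * √(g / X)) :
    J ≤ (B + c) * g ^ ((1:ℝ)/2) * (1 + X) ^ (-(1/2) : ℝ) := by
  have hg0 : 0 < g := by linarith
  rw [Real.rpow_neg (by positivity), ← Real.sqrt_eq_rpow, ← Real.sqrt_eq_rpow]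
  have hsq : J ^ 2 ≤ c ^ 2 * g / X := by
    calc J ^ 2 ≤ (c * √(g / X)) ^ 2 := by gcongr
      _ = _ := by rw [mul_pow, Real.sq_sqrt (by positivity)]; ring
  have h3 := le_mul_one_add_inv hX (sq_nonneg B) hg (pow_le_pow_left₀ hJ h1 2) hsq
  refine (sq_le_sq₀ hJ (by positivity)).1 (h3.trans ?_)
  rw [mul_pow, mul_pow, inv_pow, Real.sq_sqrt hg0.le, Real.sq_sqrt (by positivity)]
  gcongr
  nlinarith [mul_nonneg hB hc]

/-- Oscillatory integral estimate, high-frequency case `N ≥ N″` with mass `m ≠ 0`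
(Lemma 2.1 (ii)). Here `⟨m⟩ = 1 + |m|`. -/
theorem stmt_1 (n : ℕ) (hn : 1 ≤ n)
    (Ψ : (Fin n → ℝ) → ℝ) (hΨ : ∀ z, 0 ≤ Ψ z)
    (h : ℝ)
    (φ₀ : ℝ → ℝ) (hφ₀ : ContDiff ℝ (⊤ : ℕ∞) φ₀)
    (hφ₀supp : Function.support φ₀ ⊆ Set.Icc (1/4 : ℝ) 1)
    (Φ : ℝ → ℝ → (Fin n → ℝ) → ℂ)
    (hΦ : ∀ m : ℝ, m ≠ 0 → ∀ z, ContDiff ℝ (⊤ : ℕ∞) (fun s => Φ s m z))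
    (C₁ : ℝ) (hC₁ : 0 < C₁)
    (hΦbound : ∀ k : ℕ, k ≤ 1 → ∀ N : ℤ, ∀ s : ℝ, s ∈ Set.Icc (1/4 : ℝ) 1 →
      ∀ m : ℝ, m ≠ 0 → ∀ z,
      ‖iteratedDeriv k (fun s' => Φ ((2:ℝ)^N * s') m z) s‖ ≤ C₁)
    (N'' : ℤ) :
    ∃ C > 0, ∀ m : ℝ, m ≠ 0 → ∀ ε : ℝ, (ε = 1 ∨ ε = -1) → ∀ t : ℝ, t ≠ 0 →
      ∀ z : Fin n → ℝ, ∀ N : ℤ, N'' ≤ N →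
      (0 < Ψ z →
        ((|N - ⌊Real.logb 2 (Ψ z / |t|)⌋| : ℤ) : ℝ)
          ≤ 2 + (1/2) * Real.logb 2 (1 + (2:ℝ)^(-(4*(N''-2))) * m^2) →
        ‖∫ s in Set.Ioi (0:ℝ),
            Complex.exp (-(Complex.I *
              ((t * Real.sqrt ((2:ℝ)^(4*N) * s^4 + m^2) : ℝ) : ℂ)))
            * Complex.exp ((ε : ℂ) * Complex.I * (((2:ℝ)^N * s * Ψ z : ℝ) : ℂ))
            * ((s ^ h : ℝ) : ℂ) * ((φ₀ s : ℝ) : ℂ) * Φ ((2:ℝ)^N * s) m z‖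
          ≤ C * (1 + |m|) ^ ((1:ℝ)/2) * (1 + |t| * (2:ℝ)^(2*N)) ^ (-(1/2) : ℝ)) ∧
      ((Ψ z = 0 ∨
          2 + (1/2) * Real.logb 2 (1 + (2:ℝ)^(-(4*(N''-2))) * m^2)
            < ((|N - ⌊Real.logb 2 (Ψ z / |t|)⌋| : ℤ) : ℝ)) →
        ‖∫ s in Set.Ioi (0:ℝ),
            Complex.exp (-(Complex.I *
              ((t * Real.sqrt ((2:ℝ)^(4*N) * s^4 + m^2) : ℝ) : ℂ)))
            * Complex.exp ((ε : ℂ) * Complex.I * (((2:ℝ)^N * s * Ψ z : ℝ) : ℂ))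
            * ((s ^ h : ℝ) : ℂ) * ((φ₀ s : ℝ) : ℂ) * Φ ((2:ℝ)^N * s) m z‖
          ≤ C * (1 + |m|) * (1 + |t| * (2:ℝ)^(2*N))⁻¹) := by
  obtain ⟨B, hB0, hB⟩ := exists_bound_rpow_mul_cutoff_mul (by norm_num) hφ₀ hφ₀supp h hC₁.le
  have hφ1 : φ₀ 1 = 0 := hφ₀.continuous.eq_zero_of_forall_gt fun x hx => by
    by_contra hne
    exact absurd (hφ₀supp hne).2 (not_le.2 hx)
  set κ : ℝ := 1 + (2:ℝ) ^ (-(2 * N'')) with hκ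
  have hκ1 : 1 ≤ κ := le_add_of_nonneg_right (by positivity)
  set c₁ : ℝ := B * (1 + 48) * (8 * κ) with hc₁
  set c₂ : ℝ := B * (1 - 1 / 4 + 2 * Real.pi) * √(8 * κ) with hc₂
  have hπ := Real.pi_pos
  have hc₁0 : 0 ≤ c₁ := by positivity
  have hc₂0 : 0 ≤ c₂ := mul_nonneg (mul_nonneg hB0 (by linarith)) (Real.sqrt_nonneg _)
  refine ⟨B + c₁ + c₂ + 1, by positivity, fun m hm ε hε t ht z N hN => ?_⟩
  set ℓ : ℝ := (2:ℝ) ^ N with hℓ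
  have hℓ0 : 0 < ℓ := by positivity
  have e2 : (2:ℝ) ^ (2 * N) = ℓ ^ 2 := by rw [mul_comm, zpow_mul]; norm_cast
  have e4 : (2:ℝ) ^ (4 * N) = ℓ ^ 4 := by rw [mul_comm, zpow_mul]; norm_cast
  have ht0 := abs_pos.2 ht
  have hFs : ContDiff ℝ 1 (fun s => Φ (ℓ * s) m z) :=
    (contDiff_infty.1 (hΦ m hm z) 1).comp (contDiff_const.mul contDiff_id)
  obtain ⟨a', ha'c, ha⟩ := hB _ hFs
    (fun s hs => by simpa using hΦbound 0 (by norm_num) N s hs m hm z)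
    (fun s hs => by simpa using hΦbound 1 le_rfl N s hs m hm z)
  set a : ℝ → ℂ := fun x => ((x ^ h : ℝ) : ℂ) * (φ₀ x : ℂ) * Φ (ℓ * x) m z with had
  have ha1 : a 1 = 0 := by simp [had, hφ1]
  have hint : (∫ s in Set.Ioi (0:ℝ),
            Complex.exp (-(Complex.I *
              ((t * Real.sqrt ((2:ℝ)^(4*N) * s^4 + m^2) : ℝ) : ℂ)))
            * Complex.exp ((ε : ℂ) * Complex.I * ((ℓ * s * Ψ z : ℝ) : ℂ))
            * ((s ^ h : ℝ) : ℂ) * ((φ₀ s : ℝ) : ℂ) * Φ (ℓ * s) m z)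
      = ∫ s in (1 / 4 : ℝ)..1, a s * Complex.exp (Complex.I *
          ((-(t * √(ℓ ^ 4 * s ^ 4 + m ^ 2)) + ε * ℓ * Ψ z * s : ℝ) : ℂ)) := by
    rw [intervalIntegral.integral_of_le (by norm_num), ← integral_Icc_eq_integral_Ioc,
      ← setIntegral_eq_of_subset_of_forall_sdiff_eq_zero measurableSet_Ioi
        (fun s hs => lt_of_lt_of_le (by norm_num) hs.1 : Set.Icc (1 / 4 : ℝ) 1 ⊆ Set.Ioi 0)]
    · refine integral_congr_ae (Filter.Eventually.of_forall fun s => ?_)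
      simp only [had, e4]
      push_cast
      rw [show Complex.I * (-((t : ℂ) * (√(ℓ ^ 4 * s ^ 4 + m ^ 2) : ℝ)) + ε * ℓ * Ψ z * s)
        = -(Complex.I * (t * (√(ℓ ^ 4 * s ^ 4 + m ^ 2) : ℝ))) + ε * Complex.I * (ℓ * s * Ψ z) by
          ring, Complex.exp_add]
      ring
    · intro s hs
      have : φ₀ s = 0 := by
        by_contra hne
        exact hs.2 (hφ₀supp hne)
      simp [had, this]
  rw [hint, e2]
  set J := ‖∫ s in (1 / 4 : ℝ)..1, a s * Complex.exp (Complex.I *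
    ((-(t * √(ℓ ^ 4 * s ^ 4 + m ^ 2)) + ε * ℓ * Ψ z * s : ℝ) : ℂ))‖ with hJ
  have hJ0 : 0 ≤ J := norm_nonneg _
  have hJB : J ≤ B := by
    have := intervalIntegral.norm_integral_le_of_norm_le_const (a := (1 / 4 : ℝ)) (b := 1)
      (C := B) (f := fun s => a s * Complex.exp (Complex.I *
        ((-(t * √(ℓ ^ 4 * s ^ 4 + m ^ 2)) + ε * ℓ * Ψ z * s : ℝ) : ℂ))) (fun s hs => by
        rw [Set.uIoc_of_le (by norm_num)] at hs
        rw [norm_mul, Complex.norm_exp_I_mul_ofReal, mul_one]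
        exact (ha s ⟨hs.1.le, hs.2⟩).2.1.trans
          (mul_le_of_le_one_right hB0 (by nlinarith [hs.1, hs.2])))
    refine this.trans (mul_le_of_le_one_right hB0 (by norm_num))
  have hA : 0 < ℓ ^ 4 := by positivity
  have hX : 0 < |t| * ℓ ^ 2 := by positivity
  have hg : 1 ≤ 1 + |m| := by linarith [abs_nonneg m]
  have hκℓ : 1 ≤ κ * ℓ ^ 2 := by
    have h1 : (1:ℝ) ≤ (2:ℝ) ^ (-(2 * N'')) * ℓ ^ 2 := by
      rw [← e2, ← zpow_add₀ two_ne_zero]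
      exact one_le_zpow₀ one_le_two (by omega)
    refine h1.trans ?_
    gcongr
    linarith
  have hμ : |t| * ℓ ^ 2 / (8 * κ * (1 + |m|)) ≤ |t| * (ℓ ^ 4 / √(ℓ ^ 4 + m ^ 2) / 8) := by
    have := mul_le_mul_of_nonneg_left (sq_div_le_div_sqrt (m := m) hℓ0 hκℓ hκ1) ht0.le
    calc |t| * ℓ ^ 2 / (8 * κ * (1 + |m|)) = |t| * (ℓ ^ 2 / (κ * (1 + |m|))) / 8 := by
          field_simp
      _ ≤ |t| * (ℓ ^ 4 / √(ℓ ^ 4 + m ^ 2)) / 8 := by gcongr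
      _ = _ := by ring
  have hμ0 : 0 < |t| * ℓ ^ 2 / (8 * κ * (1 + |m|)) := by positivity
  refine ⟨fun _ _ => ?_, fun hsep => ?_⟩
  · have h2 : J ≤ c₂ * √((1 + |m|) / (|t| * ℓ ^ 2)) := by
      refine (norm_integral_quartic_phase_le_sqrt hA ht hB0 (fun s hs => (ha s hs).1) ha'c
        (fun s hs => (ha s hs).2.1) (fun s hs => (ha s hs).2.2) ha1).trans ?_
      calc B * (1 - 1 / 4 + 2 * Real.pi) / √(|t| * (ℓ ^ 4 / √(ℓ ^ 4 + m ^ 2) / 8))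
          ≤ B * (1 - 1 / 4 + 2 * Real.pi) / √(|t| * ℓ ^ 2 / (8 * κ * (1 + |m|))) := by
            have : (0:ℝ) ≤ 1 - 1 / 4 + 2 * Real.pi := by linarith
            have := Real.sqrt_pos.2 hμ0
            gcongr
        _ = _ := by
            rw [hc₂, mul_assoc _ (√_), ← Real.sqrt_mul (by positivity), div_eq_mul_inv,
              ← Real.sqrt_inv, inv_div, mul_div_assoc]
    refine (le_mul_rpow_one_add hX hJ0 hB0 hc₂0 hg hJB h2).trans ?_
    have hle : B + c₂ ≤ B + c₁ + c₂ + 1 := by linarith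
    gcongr
  · have hv : |ε * ℓ * Ψ z|
        ≤ |t| * (2 * ℓ ^ 4 * (1 / 4) ^ 3 / √(ℓ ^ 4 * (1 / 4) ^ 4 + m ^ 2)) ∨
        8 * √(ℓ ^ 4) * |t| ≤ |ε * ℓ * Ψ z| := by
      have e : |ε * ℓ * Ψ z| = ℓ * Ψ z := by
        rw [mul_assoc, abs_mul, abs_of_nonneg (mul_nonneg hℓ0.le (hΨ z))]
        rcases hε with rfl | rfl <;> simp
      have e' : √(ℓ ^ 4) = ℓ ^ 2 := by
        rw [show ℓ ^ 4 = (ℓ ^ 2) ^ 2 by ring, Real.sqrt_sq (by positivity)]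
      rw [e, e']
      rcases (hΨ z).eq_or_lt with h0 | h0
      · left
        rw [← h0, mul_zero]
        positivity
      · exact frequency_separation h0 ht hN (hsep.resolve_left h0.ne')
    have h2 : J ≤ c₁ * (1 + |m|) / (|t| * ℓ ^ 2) := by
      refine (norm_integral_quartic_phase_le hA ht hB0 (fun s hs => (ha s hs).1) ha'c
        (fun s hs => (ha s hs).2.1) (fun s hs => (ha s hs).2.2) ha1 hv).trans ?_
      calc B * (1 + 48) / (|t| * (ℓ ^ 4 / √(ℓ ^ 4 + m ^ 2) / 8)) * (1 - 1 / 4)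
          ≤ B * (1 + 48) / (|t| * ℓ ^ 2 / (8 * κ * (1 + |m|))) * 1 := by
            gcongr
            norm_num
        _ = _ := by rw [hc₁]; field_simp
    refine (le_mul_one_add_inv hX hB0 hg hJB h2).trans ?_
    have hle : B + c₁ ≤ B + c₁ + c₂ + 1 := by linarith
    gcongr
end

section
/- For t ≠ 0 and N₀, N ∈ ℤ define Θ_{N₀,N}(0,t) = (1 + |t| 2^{2N})^{−1/2} if |N − N₀| ≤ 2 and Θ_{N₀,N}(0,t) = (1 + |t| 2^{2N})^{−1} if |N − N₀| > 2. Then for every ℓ with −1/2 < ℓ ≤ 0 there exists C_ℓ > 0 such that for all t ≠ 0 and all N₀ ∈ ℤ: Σ_{N ∈ ℤ} 2^{(1+2ℓ)N} Θ_{N₀,N}(0,t) ≤ C_ℓ |t|^{−(1+2ℓ)/2}. -/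
open MeasureTheory

/-- A dyadic profile bound: on `[4 ^ n, 4 ^ (n + 1))` the function `x ^ b / (1 + x)` decays
geometrically in `|n|`. -/
lemma rpow_mul_inv_one_add_le {b x : ℝ} (hb0 : 0 < b) (hb : b ≤ 1 / 2) {n : ℤ}
    (h1 : (4 : ℝ) ^ n ≤ x) (h2 : x < (4 : ℝ) ^ (n + 1)) :
    x ^ b * (1 + x)⁻¹ ≤ 2 * ((4 : ℝ) ^ (-b)) ^ n.natAbs := by
  have hx : 0 < x := lt_of_lt_of_le (by positivity) h1
  have hxb : 0 < x ^ b := Real.rpow_pos_of_pos hx b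
  obtain ⟨k, rfl | rfl⟩ := n.eq_nat_or_neg
  · rw [zpow_natCast] at h1
    have hx1 : 1 ≤ x := (one_le_pow₀ (by norm_num)).trans h1
    have h3 : x ^ b * (1 + x)⁻¹ ≤ x ^ b * x⁻¹ := by
      gcongr
      linarith
    have h4 : x ^ b * x⁻¹ = x ^ (b - 1) := by
      rw [Real.rpow_sub_one hx.ne', div_eq_mul_inv]
    have h5 : x ^ (b - 1) ≤ x ^ (-b) := Real.rpow_le_rpow_of_exponent_le hx1 (by linarith)
    have h6 : x ^ (-b) ≤ ((4 : ℝ) ^ k) ^ (-b) :=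
      Real.rpow_le_rpow_of_nonpos (by positivity) h1 (by linarith)
    have h7 : ((4 : ℝ) ^ k) ^ (-b) = ((4 : ℝ) ^ (-b)) ^ k :=
      (Real.rpow_pow_comm (by norm_num) _ _).symm
    have h8 : 0 < ((4 : ℝ) ^ (-b)) ^ k := by positivity
    rw [Int.natAbs_natCast]
    linarith
  · have h3 : x ^ b * (1 + x)⁻¹ ≤ x ^ b :=
      mul_le_of_le_one_right hxb.le (inv_le_one_of_one_le₀ (by linarith))
    have h4 : x ^ b ≤ ((4 : ℝ) ^ (-(k : ℤ) + 1)) ^ b := Real.rpow_le_rpow hx.le h2.le hb0.le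
    have h5 : ((4 : ℝ) ^ (-(k : ℤ) + 1)) ^ b = 4 ^ b * ((4 : ℝ) ^ (-b)) ^ k := by
      rw [← Real.rpow_intCast, ← Real.rpow_mul (by norm_num), ← Real.rpow_natCast,
        ← Real.rpow_mul (by norm_num), ← Real.rpow_add (by norm_num)]
      push_cast
      ring_nf
    have h6 : (4 : ℝ) ^ b ≤ 2 := by
      calc (4 : ℝ) ^ b ≤ 4 ^ (1 / 2 : ℝ) :=
            Real.rpow_le_rpow_of_exponent_le (by norm_num) hb
        _ = 2 := by
            rw [← Real.sqrt_eq_rpow, show (4 : ℝ) = 2 ^ 2 by norm_num]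
            exact Real.sqrt_sq (by norm_num)
    rw [Int.natAbs_neg, Int.natAbs_natCast]
    calc _ ≤ 4 ^ b * ((4 : ℝ) ^ (-b)) ^ k := by linarith
      _ ≤ _ := by gcongr

lemma rpow_mul_one_add_rpow_neg_half_le_one {b x : ℝ} (hb0 : 0 < b) (hb : b ≤ 1 / 2)
    (hx : 0 < x) : x ^ b * (1 + x) ^ (-(1 / 2) : ℝ) ≤ 1 := by
  calc x ^ b * (1 + x) ^ (-(1 / 2) : ℝ)
      ≤ (1 + x) ^ b * (1 + x) ^ (-(1 / 2) : ℝ) := by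
        gcongr
        linarith
    _ = (1 + x) ^ (b + -(1 / 2)) := (Real.rpow_add (by linarith) _ _).symm
    _ ≤ 1 := Real.rpow_le_one_of_one_le_of_nonpos (by linarith) (by linarith)

lemma summable_pow_natAbs {r : ℝ} (h0 : 0 ≤ r) (h1 : r < 1) :
    Summable fun n : ℤ ↦ r ^ n.natAbs := by
  apply Summable.of_nat_of_neg <;>
  simpa using summable_geometric_of_lt_one h0 h1

/-- Each summand is dominated, uniformly after translating the summation variable, by a geometric
tail plus the indicator of the near-diagonal range. -/
lemma dyadic_term_le {b t : ℝ} (hb0 : 0 < b) (hb1 : b ≤ 1 / 2) (ht : t ≠ 0) {M : ℤ}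
    (hM1 : (4 : ℝ) ^ M ≤ |t|) (hM2 : |t| < (4 : ℝ) ^ (M + 1)) (N N₀ : ℤ) :
    (2:ℝ) ^ (2 * b * (N : ℝ)) *
        (if |N - N₀| ≤ 2 then (1 + |t| * (2:ℝ)^(2*N)) ^ (-(1/2) : ℝ)
         else (1 + |t| * (2:ℝ)^(2*N))⁻¹) ≤
      (2 * ((4 : ℝ) ^ (-b)) ^ (N + M).natAbs + if |N - N₀| ≤ 2 then 1 else 0) * |t| ^ (-b) := by
  have ht' : 0 < |t| := abs_pos.mpr ht
  have h4 : (2 : ℝ) ^ (2 * N) = 4 ^ N := by rw [zpow_mul]; norm_num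
  have hx : 0 < |t| * (4 : ℝ) ^ N := by positivity
  have hpow : (2 : ℝ) ^ (2 * b * (N : ℝ)) = |t| ^ (-b) * (|t| * (4 : ℝ) ^ N) ^ b := by
    rw [Real.mul_rpow ht'.le (by positivity), ← mul_assoc, ← Real.rpow_add ht', ← h4,
      ← Real.rpow_intCast, ← Real.rpow_mul (by norm_num)]
    push_cast
    rw [neg_add_cancel, Real.rpow_zero, one_mul]
    ring_nf
  have hF0 : 0 ≤ 2 * ((4 : ℝ) ^ (-b)) ^ (N + M).natAbs := by positivity
  rw [hpow, h4, mul_assoc, mul_comm]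
  refine mul_le_mul_of_nonneg_right ?_ (by positivity)
  split_ifs with h
  · linarith [rpow_mul_one_add_rpow_neg_half_le_one hb0 hb1 hx]
  · have h1 : (4 : ℝ) ^ (N + M) ≤ |t| * 4 ^ N := by
      rw [zpow_add₀ (by norm_num), mul_comm]
      gcongr
    have h2 : |t| * 4 ^ N < (4 : ℝ) ^ (N + M + 1) := by
      rw [add_assoc, zpow_add₀ (by norm_num), mul_comm]
      gcongr
    rw [add_zero]
    exact rpow_mul_inv_one_add_le hb0 hb1 h1 h2

lemma tsum_le_of_le_translates {f F G : ℤ → ℝ} {c : ℝ} (M K : ℤ) (hf : ∀ N, 0 ≤ f N)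
    (hF : Summable F) (hG : Summable G) (hle : ∀ N, f N ≤ (F (N + M) + G (N - K)) * c) :
    ∑' N, f N ≤ (∑' n, F n + ∑' n, G n) * c := by
  have hFs : Summable fun N ↦ F (N + M) := (Equiv.addRight M).summable_iff.mpr hF
  have hGs : Summable fun N ↦ G (N - K) := (Equiv.subRight K).summable_iff.mpr hG
  have hFt : ∑' N, F (N + M) = ∑' n, F n := (Equiv.addRight M).tsum_eq F
  have hGt : ∑' N, G (N - K) = ∑' n, G n := (Equiv.subRight K).tsum_eq G
  have hsum := (hFs.add hGs).mul_right c
  calc ∑' N, f N ≤ ∑' N, (F (N + M) + G (N - K)) * c :=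
        (hsum.of_nonneg_of_le hf hle).tsum_le_tsum hle hsum
    _ = (∑' n, F n + ∑' n, G n) * c := by
        rw [tsum_mul_right, hFs.tsum_add hGs, hFt, hGt]

/-- Summation lemma (Lemma 2.2 (i)): for `-1/2 < ℓ ≤ 0`,
`Σ_{N ∈ ℤ} 2^{(1+2ℓ)N} Θ_{N₀,N}(0,t) ≲_ℓ |t|^{-(1+2ℓ)/2}`. -/
theorem stmt_3 (ℓ : ℝ) (hℓ1 : -(1/2 : ℝ) < ℓ) (hℓ2 : ℓ ≤ 0) :
    ∃ C > 0, ∀ t : ℝ, t ≠ 0 → ∀ N₀ : ℤ,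
      ∑' N : ℤ, (2:ℝ) ^ ((1 + 2*ℓ) * (N : ℝ)) *
        (if |N - N₀| ≤ 2 then (1 + |t| * (2:ℝ)^(2*N)) ^ (-(1/2) : ℝ)
         else (1 + |t| * (2:ℝ)^(2*N))⁻¹)
      ≤ C * |t| ^ (-(1 + 2*ℓ)/2) := by
  obtain ⟨b, hb⟩ : ∃ b : ℝ, b = (1 + 2 * ℓ) / 2 := ⟨_, rfl⟩
  have hb0 : 0 < b := by linarith
  have hb1 : b ≤ 1 / 2 := by linarith
  rw [show -(1 + 2 * ℓ) / 2 = -b by linarith, show 1 + 2 * ℓ = 2 * b by linarith]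
  obtain ⟨F, hFdef⟩ : ∃ F : ℤ → ℝ, ∀ n, F n = 2 * ((4 : ℝ) ^ (-b)) ^ n.natAbs :=
    ⟨_, fun _ ↦ rfl⟩
  obtain ⟨G, hGdef⟩ : ∃ G : ℤ → ℝ, ∀ n, G n = if |n| ≤ 2 then 1 else 0 := ⟨_, fun _ ↦ rfl⟩
  have hF0 : ∀ n, 0 ≤ F n := fun n ↦ by rw [hFdef]; positivity
  have hG0 : ∀ n, 0 ≤ G n := fun n ↦ by rw [hGdef]; split_ifs <;> norm_num
  have hF : Summable F := by
    simp_rw [funext hFdef]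
    exact (summable_pow_natAbs (by positivity)
      (Real.rpow_lt_one_of_one_lt_of_neg (by norm_num) (by linarith))).mul_left 2
  have hG : Summable G := by
    refine summable_of_ne_finset_zero (s := Finset.Icc (-2) 2) fun n hn ↦ ?_
    rw [hGdef, if_neg]
    rwa [abs_le, ← Finset.mem_Icc]
  refine ⟨∑' n, F n + ∑' n, G n + 1,
    add_pos_of_nonneg_of_pos (add_nonneg (tsum_nonneg hF0) (tsum_nonneg hG0)) one_pos,
    fun t ht N₀ ↦ ?_⟩
  obtain ⟨M, hM1, hM2⟩ := exists_mem_Ico_zpow (y := (4 : ℝ)) (abs_pos.mpr ht) (by norm_num)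
  refine (tsum_le_of_le_translates (F := F) (G := G) (c := |t| ^ (-b)) M N₀
    (fun N ↦ ?_) hF hG fun N ↦ ?_).trans ?_
  · split_ifs <;> positivity
  · rw [hFdef, hGdef]
    exact dyadic_term_le hb0 hb1 ht hM1 hM2 N N₀
  · exact mul_le_mul_of_nonneg_right (by linarith) (by positivity)
end

section
/- Fix N″ ∈ ℤ and for m ≠ 0 set C_m = 2 + (1/2) log₂(1 + 2^{−4(N″−2)} m²). For t ≠ 0 and N₀, N ∈ ℤ define Θ_{N₀,N}(m,t) = ⟨m⟩^{1/2} (1 + |t| 2^{2N})^{−1/2} if |N − N₀| ≤ C_m and Θ_{N₀,N}(m,t) = ⟨m⟩ (1 + |t| 2^{2N})^{−1} if |N − N₀| > C_m. Then there exists C > 0, depending only on N″, such that for all m ≠ 0, all t ≠ 0 and all N₀ ∈ ℤ: Σ_{N ∈ ℤ} 2^N Θ_{N₀,N}(m,t) ≤ C ⟨m⟩ |t|^{−1/2}. -/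
open MeasureTheory

theorem rpow_neg_one_half_eq_inv_sqrt {x : ℝ} (hx : 0 ≤ x) :
    x ^ (-(1/2) : ℝ) = (√x)⁻¹ := by
  rw [Real.rpow_neg hx, Real.sqrt_eq_rpow]

theorem summable_two_inv_pow_natAbs : Summable fun j : ℤ => ((1:ℝ)/2) ^ j.natAbs := by
  apply Summable.of_nat_of_neg <;> simpa using summable_geometric_two

/-- Dyadic decay of `x / (1 + x²)` at `x = u 2^j` with `u ∈ [1, 2)`. -/
theorem div_one_add_sq_le_two_inv_pow_natAbs {u : ℝ} (h1 : 1 ≤ u) (h2 : u < 2) (j : ℤ) :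
    (u * 2 ^ j) / (1 + (u * 2 ^ j) ^ 2) ≤ 2 * ((1:ℝ)/2) ^ j.natAbs := by
  rw [div_le_iff₀ (by positivity)]
  rcases Int.natAbs_eq j with h | h
  · generalize j.natAbs = n at h
    subst h
    have hy : ((1:ℝ)/2) ^ n * 2 ^ n = 1 := by rw [← mul_pow]; norm_num
    rw [zpow_natCast]
    have hz : (0:ℝ) < (1/2) ^ n := by positivity
    have hy0 : (0:ℝ) < 2 ^ n := by positivity
    have e : 2 * ((1:ℝ)/2) ^ n * (1 + (u * 2 ^ n) ^ 2)
        = 2 * (1/2) ^ n + 2 * u ^ 2 * 2 ^ n * ((1/2) ^ n * 2 ^ n) := by ring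
    rw [e, hy]
    nlinarith [mul_nonneg (by nlinarith : 0 ≤ 2 * u ^ 2 - u) hy0.le]
  · generalize j.natAbs = n at h
    subst h
    rw [zpow_neg, zpow_natCast, ← inv_pow, one_div]
    have hz : (0:ℝ) < (2⁻¹) ^ n := by positivity
    have : 0 ≤ (2:ℝ) * (2⁻¹) ^ n * (u * (2⁻¹) ^ n) ^ 2 := by positivity
    nlinarith [mul_lt_mul_of_pos_right h2 hz]

theorem logb_two_one_add_mul_sq_le {a : ℝ} (ha : 0 < a) (m : ℝ) :
    Real.logb 2 (1 + a * m ^ 2)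
      ≤ (Real.logb 2 (1 + a) + 4 / Real.log 2) * √(1 + |m|) := by
  set w := √(1 + |m|) with hw
  have hm := abs_nonneg m
  have hw2 : w ^ 2 = 1 + |m| := Real.sq_sqrt (by positivity)
  have hw1 : 1 ≤ w := Real.one_le_sqrt.2 (by linarith)
  have hl : 0 < Real.log 2 := Real.log_pos (by norm_num)
  have h0 : 1 + a * m ^ 2 ≤ (1 + a) * w ^ 4 := by
    have e : w ^ 4 = (1 + |m|) ^ 2 := by rw [← hw2]; ring
    rw [e, ← sq_abs m]
    nlinarith [mul_nonneg ha.le hm, sq_nonneg |m|]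
  calc Real.logb 2 (1 + a * m ^ 2)
      ≤ Real.logb 2 ((1 + a) * w ^ 4) :=
        Real.logb_le_logb_of_le (by norm_num) (by positivity) h0
    _ = Real.logb 2 (1 + a) + 4 / Real.log 2 * Real.log w := by
        rw [Real.logb_mul (by positivity) (by positivity), Real.logb_pow]
        simp only [Real.logb]
        push_cast
        ring
    _ ≤ Real.logb 2 (1 + a) * w + 4 / Real.log 2 * w := by
        gcongr
        · exact le_mul_of_one_le_right (Real.logb_nonneg (by norm_num) (by linarith)) hw1
        · linarith [Real.log_le_sub_one_of_pos (by linarith : 0 < w)]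
    _ = _ := by ring

/-- Summation lemma (Lemma 2.2 (ii)):
`Σ_{N ∈ ℤ} 2^N Θ_{N₀,N}(m,t) ≲ ⟨m⟩ |t|^{-1/2}`, with `⟨m⟩ = 1 + |m|` and
`C_m = 2 + (1/2) log₂(1 + 2^{-4(N″-2)} m²)`. -/
theorem stmt_4 (N'' : ℤ) :
    ∃ C > 0, ∀ m : ℝ, m ≠ 0 → ∀ t : ℝ, t ≠ 0 → ∀ N₀ : ℤ,
      ∑' N : ℤ, (2:ℝ)^N *
        (if ((|N - N₀| : ℤ) : ℝ)
            ≤ 2 + (1/2) * Real.logb 2 (1 + (2:ℝ)^(-(4*(N''-2))) * m^2)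
         then (1 + |m|) ^ ((1:ℝ)/2) * (1 + |t| * (2:ℝ)^(2*N)) ^ (-(1/2) : ℝ)
         else (1 + |m|) * (1 + |t| * (2:ℝ)^(2*N))⁻¹)
      ≤ C * (1 + |m|) * |t| ^ (-(1/2) : ℝ) := by
  set a : ℝ := (2:ℝ)^(-(4*(N''-2))) with ha_def
  have ha : 0 < a := by positivity
  have hl : 0 < Real.log 2 := Real.log_pos (by norm_num)
  have hla : 0 ≤ Real.logb 2 (1 + a) := Real.logb_nonneg (by norm_num) (by linarith)
  set S : ℝ := ∑' j : ℤ, ((1:ℝ)/2) ^ j.natAbs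
  have hS : 0 ≤ S := tsum_nonneg fun j => by positivity
  set K : ℝ := Real.logb 2 (1 + a) + 4 / Real.log 2
  have hK : 0 ≤ K := by positivity
  refine ⟨5 + K + 2 * S, by positivity, fun m _ t ht N₀ => ?_⟩
  set c : ℝ := 2 + (1/2) * Real.logb 2 (1 + a * m^2) with hc
  have hc0 : 0 ≤ c := by
    have : 0 ≤ Real.logb 2 (1 + a * m^2) :=
      Real.logb_nonneg (by norm_num) (by nlinarith [mul_nonneg ha.le (sq_nonneg m)])
    positivity
  have hs : 0 < |t| := abs_pos.2 ht
  rw [rpow_neg_one_half_eq_inv_sqrt hs.le, ← Real.sqrt_eq_rpow]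
  have hlog := logb_two_one_add_mul_sq_le ha m
  set w := √(1 + |m|)
  have hm := abs_nonneg m
  have hw2 : 1 + |m| = w ^ 2 := (Real.sq_sqrt (by positivity)).symm
  have hw1 : 1 ≤ w := Real.one_le_sqrt.2 (by linarith)
  set r := √|t|
  have hr : 0 < r := Real.sqrt_pos.2 hs
  have hr2 : |t| = r ^ 2 := (Real.sq_sqrt hs.le).symm
  rw [hw2, hr2]
  obtain ⟨k, hk1, hk2⟩ := exists_mem_Ico_zpow hr (one_lt_two : (1:ℝ) < 2)
  have hk0 : (0:ℝ) < 2 ^ k := by positivity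
  set u := r / 2 ^ k with hu
  have hu1 : 1 ≤ u := (one_le_div hk0).2 hk1
  have hu2 : u < 2 := by
    rw [hu, div_lt_iff₀ hk0]
    rwa [zpow_add_one₀ two_ne_zero, mul_comm] at hk2
  set I := Finset.Icc (N₀ - ⌊c⌋) (N₀ + ⌊c⌋)
  have hsq (N : ℤ) : r ^ 2 * (2:ℝ)^(2*N) = (r * 2 ^ N) ^ 2 := by
    rw [mul_pow, mul_comm 2 N, zpow_mul]; norm_cast
  have hx (N : ℤ) : r * 2 ^ N = u * 2 ^ (N + k) := by
    rw [hu, zpow_add₀ two_ne_zero]; field_simp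
  let f : ℤ → ℝ := fun N => if N ∈ I then w * r⁻¹ else 0
  let g : ℤ → ℝ := fun N => 2 * w ^ 2 * r⁻¹ * ((1:ℝ)/2) ^ (N + k).natAbs
  have hf : HasSum f (∑ N ∈ I, f N) :=
    hasSum_sum_of_ne_finset_zero fun N hN => if_neg hN
  have hg : HasSum g (2 * w ^ 2 * r⁻¹ * S) :=
    ((Equiv.addRight k).hasSum_iff.2 summable_two_inv_pow_natAbs.hasSum).mul_left _
  have hfI : ∑ N ∈ I, f N ≤ (5 + K) * w ^ 2 * r⁻¹ := by
    have hcard : ((I.card : ℕ) : ℝ) ≤ (5 + K) * w := by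
      have h0 : 0 ≤ ⌊c⌋ := Int.floor_nonneg.2 hc0
      have h1 : ((I.card : ℕ) : ℤ) = 2 * ⌊c⌋ + 1 := by
        rw [Int.card_Icc]; omega
      have h2 : ((I.card : ℕ) : ℝ) = 2 * ⌊c⌋ + 1 := by exact_mod_cast h1
      rw [h2]
      nlinarith [Int.floor_le c]
    calc ∑ N ∈ I, f N = ∑ N ∈ I, w * r⁻¹ := Finset.sum_congr rfl fun N hN => if_pos hN
      _ = I.card * (w * r⁻¹) := by rw [Finset.sum_const, nsmul_eq_mul]
      _ ≤ (5 + K) * w * (w * r⁻¹) := by gcongr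
      _ = _ := by ring
  have hle (N : ℤ) : (2:ℝ)^N *
      (if ((|N - N₀| : ℤ) : ℝ) ≤ c
        then w * (1 + r ^ 2 * (2:ℝ)^(2*N)) ^ (-(1/2) : ℝ)
        else w ^ 2 * (1 + r ^ 2 * (2:ℝ)^(2*N))⁻¹) ≤ f N + g N := by
    have h2N : (0:ℝ) < 2 ^ N := by positivity
    have hg0 : 0 ≤ g N := by positivity
    rw [hsq]
    split_ifs with h
    · have hN : N ∈ I := by
        have := Int.le_floor.2 h
        rw [abs_le] at this
        exact Finset.mem_Icc.2 ⟨by omega, by omega⟩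
      have hfN : f N = w * r⁻¹ := if_pos hN
      have hroot : r * 2 ^ N ≤ √(1 + (r * 2 ^ N) ^ 2) :=
        Real.le_sqrt_of_sq_le (by linarith)
      rw [rpow_neg_one_half_eq_inv_sqrt (by positivity)]
      calc (2:ℝ) ^ N * (w * (√(1 + (r * 2 ^ N) ^ 2))⁻¹)
          ≤ 2 ^ N * (w * (r * 2 ^ N)⁻¹) := by gcongr
        _ = f N := by rw [hfN]; field_simp
        _ ≤ f N + g N := by linarith
    · have hf0 : 0 ≤ f N := by
        change 0 ≤ if N ∈ I then w * r⁻¹ else 0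
        split_ifs <;> positivity
      calc (2:ℝ) ^ N * (w ^ 2 * (1 + (r * 2 ^ N) ^ 2)⁻¹)
          = w ^ 2 * r⁻¹ * ((r * 2 ^ N) / (1 + (r * 2 ^ N) ^ 2)) := by field_simp
        _ ≤ w ^ 2 * r⁻¹ * (2 * ((1:ℝ)/2) ^ (N + k).natAbs) := by
            rw [hx]
            gcongr
            exact div_one_add_sq_le_two_inv_pow_natAbs hu1 hu2 _
        _ = g N := by ring
        _ ≤ f N + g N := by linarith
  have hfg := hf.add hg
  have hsum := Summable.of_nonneg_of_le (fun N => by split_ifs <;> positivity) hle hfg.summable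
  calc _ ≤ ∑' N, (f N + g N) := hsum.tsum_le_tsum hle hfg.summable
    _ = ∑ N ∈ I, f N + 2 * w ^ 2 * r⁻¹ * S := hfg.tsum_eq
    _ ≤ (5 + K) * w ^ 2 * r⁻¹ + 2 * w ^ 2 * r⁻¹ * S := by gcongr
    _ = _ := by ring
end

section
/- For every ℓ with −1/2 < ℓ ≤ 0 there exists C > 0 such that for all t ≠ 0 and all f ∈ 𝒮(ℝ): sup_{x ∈ ℝ} |(2π)^{−1} ∫_ℝ e^{ixξ} |ξ|^{2ℓ} e^{−itξ²} f̂(ξ) dξ| ≤ C |t|^{−(1+2ℓ)/2} ‖f‖_{L¹(ℝ)}. In other words, the one-dimensional free propagator (−Δ)^ℓ e^{itΔ} satisfies the L¹ → L^∞ bound ‖(−Δ)^ℓ e^{itΔ}‖_{L¹→L^∞} ≲_ℓ |t|^{−(1+2ℓ)/2}. -/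
open MeasureTheory

/-- The Gaussian regularisation of the free propagator maps `L¹` to `L^∞`. -/
lemma norm_integral_gaussian_mul_fourier_le {b : ℂ} (hb : 0 < b.re) {f : ℝ → ℂ}
    (hf : Integrable f) (x : ℝ) :
    ‖∫ ξ : ℝ, Complex.exp (-b * (ξ : ℂ) ^ 2) * (Complex.exp (Complex.I * ((x * ξ : ℝ) : ℂ))
        * ∫ y : ℝ, Complex.exp (-(Complex.I * ((y * ξ : ℝ) : ℂ))) * f y)‖
      ≤ (Real.pi / ‖b‖) ^ (1 / 2 : ℝ) * ∫ y : ℝ, ‖f y‖ := by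
  have hint : Integrable (Function.uncurry fun ξ y : ℝ =>
      Complex.exp (Complex.I * (((x - y) * ξ : ℝ) : ℂ))
        * (Complex.exp (-b * (ξ : ℂ) ^ 2) * f y)) (volume.prod volume) := by
    refine Integrable.bdd_mul (c := 1) ((integrable_cexp_neg_mul_sq hb).mul_prod hf) ?_ ?_
    · exact Continuous.aestronglyMeasurable (by fun_prop)
    · refine Filter.Eventually.of_forall fun p => ?_
      rw [mul_comm Complex.I, Complex.norm_exp_ofReal_mul_I]
  have hswap : (∫ ξ : ℝ, Complex.exp (-b * (ξ : ℂ) ^ 2) *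
        (Complex.exp (Complex.I * ((x * ξ : ℝ) : ℂ))
        * ∫ y : ℝ, Complex.exp (-(Complex.I * ((y * ξ : ℝ) : ℂ))) * f y))
      = ∫ y : ℝ, ((Real.pi / b) ^ (1 / 2 : ℂ)
          * Complex.exp (-((x - y : ℝ) : ℂ) ^ 2 / (4 * b))) * f y := by
    calc _ = ∫ ξ : ℝ, ∫ y : ℝ, Complex.exp (Complex.I * (((x - y) * ξ : ℝ) : ℂ))
        * (Complex.exp (-b * (ξ : ℂ) ^ 2) * f y) := by
          refine integral_congr_ae (Filter.Eventually.of_forall fun ξ => ?_)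
          simp only
          rw [← integral_const_mul, ← integral_const_mul]
          refine integral_congr_ae (Filter.Eventually.of_forall fun y => ?_)
          have : Complex.exp (Complex.I * (((x - y) * ξ : ℝ) : ℂ))
              = Complex.exp (Complex.I * ((x * ξ : ℝ) : ℂ))
                * Complex.exp (-(Complex.I * ((y * ξ : ℝ) : ℂ))) := by
            rw [← Complex.exp_add]
            congr 1
            push_cast
            ring
          simp only [this]
          ring
      _ = _ := by
          rw [integral_integral_swap hint]
          refine integral_congr_ae (Filter.Eventually.of_forall fun y => ?_)
          simp only
          rw [← fourierIntegral_gaussian hb, ← integral_mul_const]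
          refine integral_congr_ae (Filter.Eventually.of_forall fun ξ => ?_)
          simp only
          push_cast
          ring_nf
  rw [hswap, ← integral_const_mul]
  refine norm_integral_le_of_norm_le (hf.norm.const_mul _)
    (Filter.Eventually.of_forall fun y => ?_)
  rw [norm_mul]
  refine mul_le_mul_of_nonneg_right ?_ (norm_nonneg _)
  have h1 : ‖((Real.pi : ℂ) / b) ^ (1 / 2 : ℂ)‖ = (Real.pi / ‖b‖) ^ (1 / 2 : ℝ) := by
    have := Complex.norm_cpow_real ((Real.pi : ℂ) / b) (1 / 2)
    push_cast at this
    rw [this, norm_div, Complex.norm_real, Real.norm_of_nonneg Real.pi_pos.le]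
  have h2 : ‖Complex.exp (-((x - y : ℝ) : ℂ) ^ 2 / (4 * b))‖ ≤ 1 := by
    rw [Complex.norm_exp, Real.exp_le_one_iff]
    have : -((x - y : ℝ) : ℂ) ^ 2 / (4 * b) = ((-((x - y) ^ 2 / 4) : ℝ) : ℂ) * b⁻¹ := by
      push_cast
      rw [div_eq_mul_inv, mul_inv]
      ring
    rw [this, Complex.re_ofReal_mul, Complex.inv_re]
    have : 0 ≤ b.re / Complex.normSq b := div_nonneg hb.le (Complex.normSq_nonneg _)
    have h3 : 0 ≤ (x - y) ^ 2 / 4 := by positivity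
    nlinarith
  rw [norm_mul, h1]
  exact mul_le_of_le_one_right (by positivity) h2

/-- Negative powers of `ξ²` as superpositions of Gaussians, integrated against a function. -/
lemma integral_rpow_mul_eq_integral_gaussian {a : ℝ} (ha : 0 < a) {h : ℝ → ℂ}
    (hm : AEStronglyMeasurable h) (hint : Integrable fun ξ : ℝ => |ξ| ^ (-2 * a) * ‖h ξ‖) :
    (Real.Gamma a : ℂ) * ∫ ξ : ℝ, ((|ξ| ^ (-2 * a) : ℝ) : ℂ) * h ξ
      = ∫ s in Set.Ioi (0 : ℝ), ((s ^ (a - 1) : ℝ) : ℂ)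
          * ∫ ξ : ℝ, ((Real.exp (-(s * ξ ^ 2)) : ℝ) : ℂ) * h ξ := by
  have hne : ∀ᵐ ξ : ℝ, ξ ≠ 0 := by
    simp [ae_iff]
  have hG : ∀ ξ : ℝ, ξ ≠ 0 → ∫ s in Set.Ioi (0 : ℝ), s ^ (a - 1) * Real.exp (-(s * ξ ^ 2))
      = Real.Gamma a * |ξ| ^ (-2 * a) := by
    intro ξ hξ
    have := Real.integral_rpow_mul_exp_neg_mul_Ioi ha (sq_pos_of_ne_zero hξ)
    simp only [mul_comm (ξ ^ 2)] at this
    rw [this, mul_comm, Real.rpow_mul (abs_nonneg ξ), one_div, ← sq_abs,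
      Real.rpow_neg (abs_nonneg ξ), Real.rpow_two]
  have hI : Integrable (Function.uncurry fun ξ s : ℝ =>
      ((s ^ (a - 1) * Real.exp (-(s * ξ ^ 2)) : ℝ) : ℂ) * h ξ)
      (volume.prod (volume.restrict (Set.Ioi (0 : ℝ)))) := by
    rw [integrable_prod_iff]
    · constructor
      · filter_upwards [hne] with ξ hξ
        have hξ' : Integrable (fun s : ℝ => s ^ (a - 1) * Real.exp (-(s * ξ ^ 2)))
            (volume.restrict (Set.Ioi 0)) := by
          have := integrableOn_rpow_mul_exp_neg_mul_rpow (p := 1) (s := a - 1) (b := ξ ^ 2)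
            (by linarith) one_pos (sq_pos_of_ne_zero hξ)
          simpa [mul_comm, IntegrableOn] using this
        exact (hξ'.ofReal (𝕜 := ℂ)).mul_const (h ξ)
      · refine (hint.const_mul (Real.Gamma a)).congr ?_
        filter_upwards [hne] with ξ hξ
        rw [← mul_assoc, ← hG ξ hξ, ← integral_mul_const]
        refine setIntegral_congr_fun measurableSet_Ioi fun s hs => ?_
        have hs' : (0 : ℝ) < s := hs
        simp only [Function.uncurry, norm_mul, Complex.norm_real]
        rw [Real.norm_of_nonneg (by positivity), Real.norm_of_nonneg (by positivity)]
    · refine AEStronglyMeasurable.mul ?_ hm.comp_fst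
      exact Measurable.aestronglyMeasurable (by fun_prop)
  calc _ = ∫ ξ : ℝ, ∫ s in Set.Ioi (0 : ℝ),
        ((s ^ (a - 1) * Real.exp (-(s * ξ ^ 2)) : ℝ) : ℂ) * h ξ := by
        rw [← integral_const_mul]
        refine integral_congr_ae ?_
        filter_upwards [hne] with ξ hξ
        rw [integral_mul_const, integral_complex_ofReal, hG ξ hξ]
        push_cast
        ring
    _ = _ := by
        rw [integral_integral_swap hI]
        refine integral_congr_ae (Filter.Eventually.of_forall fun s => ?_)
        simp only
        rw [← integral_const_mul]
        refine integral_congr_ae (Filter.Eventually.of_forall fun ξ => ?_)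
        simp only
        push_cast
        ring

/-- A function that is bounded and integrable stays integrable against an integrable power
singularity at the origin. -/
lemma integrable_abs_rpow_mul_norm {r M : ℝ} (hr : -1 < r) (hr' : r ≤ 0) {g : ℝ → ℂ}
    (hg : Integrable g) (hM : ∀ ξ, ‖g ξ‖ ≤ M) :
    Integrable fun ξ : ℝ => |ξ| ^ r * ‖g ξ‖ := by
  have hloc : IntegrableOn (fun ξ : ℝ => |ξ| ^ r) (Set.Ioc (-1) 1) := by
    have h1 : IntervalIntegrable (fun ξ : ℝ => |ξ| ^ r) volume 0 1 := by
      refine (intervalIntegral.intervalIntegrable_rpow' hr).congr fun ξ hξ => ?_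
      rw [Set.uIoc_of_le zero_le_one] at hξ
      simp only [abs_of_pos hξ.1]
    have h2 : IntervalIntegrable (fun ξ : ℝ => |ξ| ^ r) volume (-1) 0 := by
      have := (h1.comp_sub_left 0).symm
      simpa using this
    exact (intervalIntegrable_iff_integrableOn_Ioc_of_le (by norm_num)).1 (h2.trans h1)
  have hdom : Integrable fun ξ : ℝ =>
      (Set.Ioc (-1 : ℝ) 1).indicator (fun ξ : ℝ => |ξ| ^ r * M) ξ + ‖g ξ‖ :=
    ((integrable_indicator_iff measurableSet_Ioc).2 (hloc.mul_const M)).add hg.norm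
  refine hdom.mono' ?_ (Filter.Eventually.of_forall fun ξ => ?_)
  · exact (Measurable.aestronglyMeasurable (by fun_prop)).mul hg.aestronglyMeasurable.norm
  · rw [Real.norm_of_nonneg (by positivity)]
    by_cases hξ : ξ ∈ Set.Ioc (-1 : ℝ) 1
    · rw [Set.indicator_of_mem hξ]
      have := mul_le_mul_of_nonneg_left (hM ξ) (Real.rpow_nonneg (abs_nonneg ξ) r)
      linarith [norm_nonneg (g ξ)]
    · rw [Set.indicator_of_notMem hξ, zero_add]
      refine mul_le_of_le_one_left (norm_nonneg _) (Real.rpow_le_one_of_one_le_of_nonpos ?_ hr')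
      by_contra! hlt
      exact hξ ⟨(abs_lt.1 hlt).1, (abs_lt.1 hlt).2.le⟩

/-- A power weight integrated against the smaller of `T ^ (-1/2)` and `s ^ (-1/2)`. -/
lemma norm_setIntegral_rpow_mul_le {a T K : ℝ} (ha : 0 < a) (ha' : a < 1 / 2) (hT : 0 < T)
    {F : ℝ → ℂ} (h1 : ∀ s, 0 < s → ‖F s‖ ≤ K * T ^ (-(1 / 2) : ℝ))
    (h2 : ∀ s, 0 < s → ‖F s‖ ≤ K * s ^ (-(1 / 2) : ℝ)) :
    ‖∫ s in Set.Ioi (0 : ℝ), ((s ^ (a - 1) : ℝ) : ℂ) * F s‖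
      ≤ K * (1 / a + 1 / (1 / 2 - a)) * T ^ (a - 1 / 2) := by
  set G : ℝ → ℝ := fun s => if s ≤ T then K * T ^ (-(1 / 2) : ℝ) * s ^ (a - 1)
    else K * s ^ (a - 3 / 2) with hGdef
  have e1 : Set.EqOn (fun s => K * T ^ (-(1 / 2) : ℝ) * s ^ (a - 1)) G (Set.Ioc 0 T) := by
    intro s hs
    simp [hGdef, hs.2]
  have e2 : Set.EqOn (fun s => K * s ^ (a - 3 / 2)) G (Set.Ioi T) := by
    intro s hs
    have : ¬ s ≤ T := not_le.2 hs
    simp [hGdef, this]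
  have i1 : IntegrableOn G (Set.Ioc 0 T) := by
    refine IntegrableOn.congr_fun ?_ e1 measurableSet_Ioc
    exact ((intervalIntegrable_iff_integrableOn_Ioc_of_le hT.le).1
      (intervalIntegral.intervalIntegrable_rpow' (by linarith))).const_mul _
  have i2 : IntegrableOn G (Set.Ioi T) := by
    refine IntegrableOn.congr_fun ?_ e2 measurableSet_Ioi
    exact (integrableOn_Ioi_rpow_of_lt (by linarith) hT).const_mul _
  have i3 : IntegrableOn G (Set.Ioi 0) := by
    rw [← Set.Ioc_union_Ioi_eq_Ioi hT.le]
    exact i1.union i2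
  have hval : ∫ s in Set.Ioi (0 : ℝ), G s
      = K * (1 / a + 1 / (1 / 2 - a)) * T ^ (a - 1 / 2) := by
    rw [← Set.Ioc_union_Ioi_eq_Ioi hT.le,
      setIntegral_union Set.Ioc_disjoint_Ioi_same measurableSet_Ioi i1 i2,
      ← setIntegral_congr_fun measurableSet_Ioc e1, ← setIntegral_congr_fun measurableSet_Ioi e2,
      integral_const_mul, integral_const_mul, integral_Ioi_rpow_of_lt (by linarith) hT,
      ← intervalIntegral.integral_of_le hT.le, integral_rpow (Or.inl (by linarith)),
      sub_add_cancel, Real.zero_rpow ha.ne', sub_zero]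
    have p1 : T ^ (a - 1 / 2) = T ^ (-(1 / 2) : ℝ) * T ^ a := by
      rw [← Real.rpow_add hT]
      ring_nf
    have p2 : a - 3 / 2 + 1 = -(1 / 2 - a) := by ring
    have p3 : -(1 / 2 - a) = a - 1 / 2 := by ring
    have p4 : -T ^ (a - 1 / 2) / -(1 / 2 - a) = T ^ (a - 1 / 2) / (1 / 2 - a) := neg_div_neg_eq _ _
    rw [p2, show T ^ (-(1 / 2 - a)) = T ^ (a - 1 / 2) by rw [p3], p4, p1]
    ring
  rw [← hval]
  refine norm_integral_le_of_norm_le i3 ?_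
  refine (ae_restrict_iff' measurableSet_Ioi).2 (Filter.Eventually.of_forall fun s hs => ?_)
  have hs' : (0 : ℝ) < s := hs
  have hp : 0 ≤ s ^ (a - 1) := by positivity
  rw [norm_mul, Complex.norm_real, Real.norm_of_nonneg hp]
  simp only [hGdef]
  split_ifs
  · calc _ ≤ s ^ (a - 1) * (K * T ^ (-(1 / 2) : ℝ)) := mul_le_mul_of_nonneg_left (h1 s hs') hp
      _ = _ := by ring
  · calc _ ≤ s ^ (a - 1) * (K * s ^ (-(1 / 2) : ℝ)) := mul_le_mul_of_nonneg_left (h2 s hs') hp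
      _ = K * (s ^ (a - 1) * s ^ (-(1 / 2) : ℝ)) := by ring
      _ = _ := by
        rw [← Real.rpow_add hs']
        ring_nf

lemma norm_exp_I_mul_ofReal_mul_exp_neg (u v : ℝ) :
    ‖Complex.exp (Complex.I * (u : ℂ)) * Complex.exp (-(Complex.I * (v : ℂ)))‖ = 1 := by
  rw [← Complex.exp_add, show Complex.I * (u : ℂ) + -(Complex.I * (v : ℂ))
    = ((u - v : ℝ) : ℂ) * Complex.I by push_cast; ring, Complex.norm_exp_ofReal_mul_I]

/-- The Fourier integral of a Schwartz function without `2π` in the exponent is integrable. -/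
lemma integrable_fourierIntegral_schwartz (f : SchwartzMap ℝ ℂ) :
    Integrable fun ξ : ℝ => ∫ y : ℝ, Complex.exp (-(Complex.I * ((y * ξ : ℝ) : ℂ))) * f y := by
  have h := (FourierTransform.fourier f).integrable (μ := volume)
  rw [SchwartzMap.fourier_coe] at h
  have h2 := h.comp_div (R := 2 * Real.pi) (by positivity)
  refine h2.congr (Filter.Eventually.of_forall fun ξ => ?_)
  simp only [Real.fourier_real_eq_integral_exp_smul, smul_eq_mul]
  refine integral_congr_ae (Filter.Eventually.of_forall fun y => ?_)
  have : -2 * Real.pi * y * (ξ / (2 * Real.pi)) = -(y * ξ) := by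
    field_simp
  simp only [this]
  congr 2
  push_cast
  ring

/-- Free dispersive estimate (Proposition 2.3 (i)):
`‖(-Δ)^ℓ e^{itΔ}‖_{L¹→L^∞} ≲_ℓ |t|^{-(1+2ℓ)/2}` for `-1/2 < ℓ ≤ 0` in one dimension,
written via the Fourier multiplier with symbol `|ξ|^{2ℓ} e^{-itξ²}`. -/
theorem stmt_6 (ℓ : ℝ) (hℓ1 : -(1/2 : ℝ) < ℓ) (hℓ2 : ℓ ≤ 0) :
    ∃ C > 0, ∀ t : ℝ, t ≠ 0 → ∀ f : SchwartzMap ℝ ℂ, ∀ x : ℝ,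
      ‖(2 * Real.pi)⁻¹ • ∫ ξ : ℝ,
          Complex.exp (Complex.I * ((x * ξ : ℝ) : ℂ))
          * ((|ξ| ^ (2*ℓ) : ℝ) : ℂ)
          * Complex.exp (-(Complex.I * ((t * ξ^2 : ℝ) : ℂ)))
          * (∫ y : ℝ, Complex.exp (-(Complex.I * ((y * ξ : ℝ) : ℂ))) * f y)‖
      ≤ C * |t| ^ (-(1 + 2*ℓ)/2) * ∫ y : ℝ, ‖f y‖ := by
  set r : ℝ := Real.pi ^ (1 / 2 : ℝ) with hr
  have hr0 : 0 < r := by positivity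
  have key : ∀ t : ℝ, t ≠ 0 → ∀ f : SchwartzMap ℝ ℂ, ∀ x s : ℝ, 0 < s →
      ∀ T : ℝ, 0 < T → T ≤ max |t| s →
      ‖∫ ξ : ℝ, ((Real.exp (-(s * ξ ^ 2)) : ℝ) : ℂ) *
        (Complex.exp (Complex.I * ((x * ξ : ℝ) : ℂ))
          * Complex.exp (-(Complex.I * ((t * ξ^2 : ℝ) : ℂ)))
          * (∫ y : ℝ, Complex.exp (-(Complex.I * ((y * ξ : ℝ) : ℂ))) * f y))‖
      ≤ r * (∫ y : ℝ, ‖f y‖) * T ^ (-(1 / 2) : ℝ) := by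
    intro t ht f x s hs T hT hTle
    have hb : 0 < ((s : ℂ) + t * Complex.I).re := by simpa using hs
    have h := norm_integral_gaussian_mul_fourier_le hb (f.integrable (μ := volume)) x
    have hnorm : T ≤ ‖(s : ℂ) + t * Complex.I‖ := by
      refine hTle.trans (max_le ?_ ?_)
      · simpa using Complex.abs_im_le_norm ((s : ℂ) + t * Complex.I)
      · simpa using Complex.re_le_norm ((s : ℂ) + t * Complex.I)
    calc _ = _ := ?_
      _ ≤ _ := h
      _ ≤ (Real.pi / T) ^ (1 / 2 : ℝ) * ∫ y : ℝ, ‖f y‖ := by gcongr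
      _ = _ := by
        rw [Real.div_rpow Real.pi_pos.le hT.le, Real.rpow_neg hT.le]
        ring
    congr 1
    refine integral_congr_ae (Filter.Eventually.of_forall fun ξ => ?_)
    have : Complex.exp (-((s : ℂ) + t * Complex.I) * (ξ : ℂ) ^ 2)
        = ((Real.exp (-(s * ξ ^ 2)) : ℝ) : ℂ)
          * Complex.exp (-(Complex.I * ((t * ξ^2 : ℝ) : ℂ))) := by
      rw [Complex.ofReal_exp, ← Complex.exp_add]
      congr 1
      push_cast
      ring
    simp only [this]
    ring
  have hint : ∀ (t : ℝ) (f : SchwartzMap ℝ ℂ) (x : ℝ),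
      Integrable fun ξ : ℝ => Complex.exp (Complex.I * ((x * ξ : ℝ) : ℂ))
          * Complex.exp (-(Complex.I * ((t * ξ^2 : ℝ) : ℂ)))
          * (∫ y : ℝ, Complex.exp (-(Complex.I * ((y * ξ : ℝ) : ℂ))) * f y) := by
    intro t f x
    refine (integrable_fourierIntegral_schwartz f).bdd_mul (c := 1) ?_ ?_
    · exact Continuous.aestronglyMeasurable (by fun_prop)
    · exact Filter.Eventually.of_forall fun ξ => (norm_exp_I_mul_ofReal_mul_exp_neg _ _).le
  have hbdd : ∀ (t : ℝ) (f : SchwartzMap ℝ ℂ) (x ξ : ℝ),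
      ‖Complex.exp (Complex.I * ((x * ξ : ℝ) : ℂ))
          * Complex.exp (-(Complex.I * ((t * ξ^2 : ℝ) : ℂ)))
          * (∫ y : ℝ, Complex.exp (-(Complex.I * ((y * ξ : ℝ) : ℂ))) * f y)‖
        ≤ ∫ y : ℝ, ‖f y‖ := by
    intro t f x ξ
    have h1 : ‖∫ y : ℝ, Complex.exp (-(Complex.I * ((y * ξ : ℝ) : ℂ))) * f y‖
        ≤ ∫ y : ℝ, ‖f y‖ := by
      refine norm_integral_le_of_norm_le (f.integrable (μ := volume)).norm
        (Filter.Eventually.of_forall fun y => ?_)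
      simp [Complex.norm_exp]
    rwa [norm_mul, norm_exp_I_mul_ofReal_mul_exp_neg, one_mul]
  have hpi : 0 < (2 * Real.pi)⁻¹ := by positivity
  rcases hℓ2.lt_or_eq with hℓ | hℓ
  · have ha : 0 < -ℓ := by linarith
    have hΓ : 0 < Real.Gamma (-ℓ) := Real.Gamma_pos_of_pos ha
    have hd : 0 < 1 / 2 - -ℓ := by linarith
    refine ⟨(2 * Real.pi)⁻¹ * (r * (1 / -ℓ + 1 / (1 / 2 - -ℓ)) / Real.Gamma (-ℓ)), by positivity,
      fun t ht f x => ?_⟩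
    have hrep := integral_rpow_mul_eq_integral_gaussian ha (hint t f x).aestronglyMeasurable
      (integrable_abs_rpow_mul_norm (by linarith) (by linarith) (hint t f x) (hbdd t f x))
    have hT : 0 < |t| := abs_pos.2 ht
    have hbound := norm_setIntegral_rpow_mul_le ha (by linarith) hT
      (fun s hs => key t ht f x s hs |t| hT (le_max_left _ _))
      (fun s hs => key t ht f x s hs s hs (le_max_right _ _))
    rw [← hrep, norm_mul, Complex.norm_real, Real.norm_of_nonneg hΓ.le] at hbound
    rw [norm_smul, Real.norm_of_nonneg hpi.le]
    have hexp : -(1 + 2 * ℓ) / 2 = -ℓ - 1 / 2 := by ring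
    have hpow : -2 * -ℓ = 2 * ℓ := by ring
    rw [hpow] at hbound
    rw [hexp, mul_assoc, mul_assoc]
    refine mul_le_mul_of_nonneg_left ?_ hpi.le
    rw [div_mul_eq_mul_div, le_div_iff₀ hΓ, mul_comm]
    calc _ = _ := ?_
      _ ≤ _ := hbound
      _ = _ := by ring
    congr 2
    refine integral_congr_ae (Filter.Eventually.of_forall fun ξ => ?_)
    simp only
    ring
  · subst hℓ
    refine ⟨(2 * Real.pi)⁻¹ * r, by positivity, fun t ht f x => ?_⟩
    have hT : 0 < |t| := abs_pos.2 ht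
    rw [norm_smul, Real.norm_of_nonneg hpi.le, mul_assoc, mul_assoc]
    refine mul_le_mul_of_nonneg_left ?_ hpi.le
    have hlim : Filter.Tendsto (fun s : ℝ => ∫ ξ : ℝ, ((Real.exp (-(s * ξ ^ 2)) : ℝ) : ℂ) *
        (Complex.exp (Complex.I * ((x * ξ : ℝ) : ℂ))
          * Complex.exp (-(Complex.I * ((t * ξ^2 : ℝ) : ℂ)))
          * (∫ y : ℝ, Complex.exp (-(Complex.I * ((y * ξ : ℝ) : ℂ))) * f y)))
        (nhdsWithin 0 (Set.Ioi 0))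
        (nhds (∫ ξ : ℝ, Complex.exp (Complex.I * ((x * ξ : ℝ) : ℂ))
          * Complex.exp (-(Complex.I * ((t * ξ^2 : ℝ) : ℂ)))
          * (∫ y : ℝ, Complex.exp (-(Complex.I * ((y * ξ : ℝ) : ℂ))) * f y))) := by
      refine tendsto_integral_filter_of_dominated_convergence _ ?_ ?_ (hint t f x).norm ?_
      · refine Filter.Eventually.of_forall fun s => ?_
        exact (Continuous.aestronglyMeasurable (by fun_prop)).mul (hint t f x).aestronglyMeasurable
      · filter_upwards [self_mem_nhdsWithin] with s hs
        refine Filter.Eventually.of_forall fun ξ => ?_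
        have hs' : (0 : ℝ) < s := hs
        rw [norm_mul, Complex.norm_real, Real.norm_of_nonneg (Real.exp_pos _).le]
        refine mul_le_of_le_one_left (norm_nonneg _) (Real.exp_le_one_iff.2 ?_)
        have : 0 ≤ s * ξ ^ 2 := by positivity
        linarith
      · refine Filter.Eventually.of_forall fun ξ => ?_
        have hc : Continuous fun s : ℝ => ((Real.exp (-(s * ξ ^ 2)) : ℝ) : ℂ) *
            (Complex.exp (Complex.I * ((x * ξ : ℝ) : ℂ))
            * Complex.exp (-(Complex.I * ((t * ξ^2 : ℝ) : ℂ)))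
            * (∫ y : ℝ, Complex.exp (-(Complex.I * ((y * ξ : ℝ) : ℂ))) * f y)) := by fun_prop
        have := (hc.tendsto 0).mono_left (nhdsWithin_le_nhds (s := Set.Ioi 0))
        simpa only [zero_mul, neg_zero, Real.exp_zero, Complex.ofReal_one, one_mul] using this
    have hle := le_of_tendsto hlim.norm
      (b := r * (∫ y : ℝ, ‖f y‖) * |t| ^ (-(1 / 2) : ℝ)) <| by
        filter_upwards [self_mem_nhdsWithin] with s hs
        exact key t ht f x s hs |t| hT (le_max_left _ _)
    have hexp : -(1 + 2 * (0 : ℝ)) / 2 = -(1 / 2) := by norm_num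
    rw [hexp]
    calc _ = _ := ?_
      _ ≤ _ := hle
      _ = _ := by ring
    simp
end

section
/- There exists C > 0 such that for all t ≠ 0 and all f ∈ 𝒮(ℝ): sup_{x ∈ ℝ} |(2π)^{−1} ∫_ℝ e^{ixξ} (sin(tξ²)/ξ²) f̂(ξ) dξ| ≤ C |t|^{1/2} ‖f‖_{L¹(ℝ)}. In other words, the one-dimensional operator sin(tΔ)/Δ satisfies ‖sin(tΔ)/Δ‖_{L¹→L^∞} ≲ |t|^{1/2}. -/
open MeasureTheory

theorem abs_sin_mul_sq_div_sq_le (t ξ : ℝ) :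
    |Real.sin (t * ξ ^ 2) / ξ ^ 2| ≤ 2 * |t| * (1 + (√|t| * ξ) ^ 2)⁻¹ := by
  rcases eq_or_ne ξ 0 with rfl | hξ
  · simp
  have hξ2 : 0 < ξ ^ 2 := by positivity
  have h1 := Real.abs_sin_le_one (t * ξ ^ 2)
  have h2 : |Real.sin (t * ξ ^ 2)| ≤ |t| * ξ ^ 2 :=
    Real.abs_sin_le_abs.trans_eq (by rw [abs_mul, abs_of_pos hξ2])
  have h0 : 0 ≤ |t| * ξ ^ 2 := by positivity
  rw [mul_pow, Real.sq_sqrt (abs_nonneg t), abs_div, abs_of_pos hξ2, ← div_eq_mul_inv,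
    div_le_div_iff₀ hξ2 (by positivity)]
  nlinarith [mul_le_mul_of_nonneg_right h1 h0]

theorem integrable_inv_one_add_sqrt_mul_sq {t : ℝ} (ht : t ≠ 0) :
    Integrable fun ξ : ℝ => (1 + (√|t| * ξ) ^ 2)⁻¹ :=
  integrable_inv_one_add_sq.comp_mul_left' (R := √|t|) (by positivity)

theorem integral_two_mul_abs_mul_inv_one_add_sqrt_mul_sq {t : ℝ} (ht : t ≠ 0) :
    ∫ ξ : ℝ, 2 * |t| * (1 + (√|t| * ξ) ^ 2)⁻¹ = 2 * Real.pi * √|t| := by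
  have hs : 0 < √|t| := by positivity
  rw [integral_const_mul, Measure.integral_comp_mul_left (fun x : ℝ => (1 + x ^ 2)⁻¹),
    integral_univ_inv_one_add_sq, abs_of_pos (inv_pos.2 hs), smul_eq_mul]
  field_simp
  rw [Real.sq_sqrt (abs_nonneg t)]

theorem norm_integral_exp_neg_I_mul_le (f : ℝ → ℂ) (ξ : ℝ) :
    ‖∫ y : ℝ, Complex.exp (-(Complex.I * ((y * ξ : ℝ) : ℂ))) * f y‖ ≤ ∫ y : ℝ, ‖f y‖ := by
  refine (norm_integral_le_integral_norm _).trans_eq (integral_congr_ae (.of_forall fun y => ?_))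
  simp [Complex.norm_exp]

/-- Free estimate (Proposition 2.3 (ii)):
`‖sin(tΔ)/Δ‖_{L¹→L^∞} ≲ |t|^{1/2}` in one dimension, written via the Fourier
multiplier with symbol `sin(tξ²)/ξ²` (interpreted as `t` at `ξ = 0`). -/
theorem stmt_8 :
    ∃ C > 0, ∀ t : ℝ, t ≠ 0 → ∀ f : SchwartzMap ℝ ℂ, ∀ x : ℝ,
      ‖(2 * Real.pi)⁻¹ • ∫ ξ : ℝ,
          Complex.exp (Complex.I * ((x * ξ : ℝ) : ℂ))
          * (if ξ = 0 then ((t : ℝ) : ℂ)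
             else ((Real.sin (t * ξ^2) / ξ^2 : ℝ) : ℂ))
          * (∫ y : ℝ, Complex.exp (-(Complex.I * ((y * ξ : ℝ) : ℂ))) * f y)‖
      ≤ C * |t| ^ ((1:ℝ)/2) * ∫ y : ℝ, ‖f y‖ := by
  refine ⟨1, one_pos, fun t ht f x => ?_⟩
  set M := ∫ y : ℝ, ‖f y‖
  have hbound : ∀ ξ : ℝ, ‖Complex.exp (Complex.I * ((x * ξ : ℝ) : ℂ))
          * (if ξ = 0 then ((t : ℝ) : ℂ)
             else ((Real.sin (t * ξ^2) / ξ^2 : ℝ) : ℂ))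
          * (∫ y : ℝ, Complex.exp (-(Complex.I * ((y * ξ : ℝ) : ℂ))) * f y)‖
      ≤ 2 * |t| * (1 + (√|t| * ξ) ^ 2)⁻¹ * M := by
    intro ξ
    rw [norm_mul, norm_mul, mul_comm Complex.I, Complex.norm_exp_ofReal_mul_I, one_mul]
    refine mul_le_mul ?_ (norm_integral_exp_neg_I_mul_le f ξ) (norm_nonneg _) (by positivity)
    split_ifs with h
    · subst h
      simp only [Complex.norm_real, Real.norm_eq_abs]
      norm_num
      linarith [abs_nonneg t]
    · rw [Complex.norm_real, Real.norm_eq_abs]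
      exact abs_sin_mul_sq_div_sq_le t ξ
  have hint := norm_integral_le_of_norm_le
    (((integrable_inv_one_add_sqrt_mul_sq ht).const_mul (2 * |t|)).mul_const M)
    (.of_forall hbound)
  rw [integral_mul_const, integral_two_mul_abs_mul_inv_one_add_sqrt_mul_sq ht] at hint
  rw [norm_smul, Real.norm_of_nonneg (by positivity), ← Real.sqrt_eq_rpow, one_mul]
  calc _ ≤ (2 * Real.pi)⁻¹ * (2 * Real.pi * √|t| * M) := by gcongr
    _ = √|t| * M := by field_simp
end
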